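/- Let r, c ≥ 1, n = rc, and P, Q ∈ SYT(r×c), and set S = stack(P,Q). Then prom_r(S) ∈ S_{2n} is a fixed-point-free involution, and every 2-cycle (a b) of prom_r(S) satisfies a ∈ {1,…,n} and b ∈ {n+1,…,2n}. -/

import Mathlib

namespace PromRS

/-! ## Rectangular standard Young tableaux (as functions; 0-indexed cells; entries 1..R*C) -/

/-- `T` is a standard Young tableau of rectangular shape with `R` rows and `C` columns:
rows and columns strictly increase, and the entries on the `R × C` rectangle are a
bijection onto `{1, …, R*C}`. -/
def IsSYT (R C : ℕ) (T : ℕ → ℕ → ℕ) : Prop :=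
  (∀ i j, i < R → j + 1 < C → T i j < T i (j + 1)) ∧
  (∀ i j, i + 1 < R → j < C → T i j < T (i + 1) j) ∧
  Set.BijOn (fun p : ℕ × ℕ => T p.1 p.2) {p : ℕ × ℕ | p.1 < R ∧ p.2 < C} (Set.Icc 1 (R * C))

/-- Stacking: add `r*c` to every entry of `Q` and place the result below `P`. -/
def stack (r c : ℕ) (P Q : ℕ → ℕ → ℕ) : ℕ → ℕ → ℕ := fun i j =>
  if i < r then P i j else Q (i - r) j + r * c

/-! ## Gromotion and promotion permutations -/

/-- Value of `T` at a cell, with `⊤` outside the `R × C` rectangle. -/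
def ext (R C : ℕ) (T : ℕ → ℕ → ℕ) (p : ℕ × ℕ) : WithTop ℕ :=
  if p.1 < R ∧ p.2 < C then ((T p.1 p.2 : ℕ) : WithTop ℕ) else ⊤

/-- The jeu de taquin slide moves the empty cell to the smaller of its east/south neighbors. -/
def nextCell (R C : ℕ) (T : ℕ → ℕ → ℕ) (p : ℕ × ℕ) : ℕ × ℕ :=
  if ext R C T (p.1, p.2 + 1) < ext R C T (p.1 + 1, p.2) then (p.1, p.2 + 1)
  else (p.1 + 1, p.2)

/-- The sliding path of the empty cell, starting at the top-left corner. -/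
def slidePath (R C : ℕ) (T : ℕ → ℕ → ℕ) : ℕ → ℕ × ℕ
  | 0 => (0, 0)
  | k + 1 => nextCell R C T (slidePath R C T k)

def maxEntry (R C : ℕ) (T : ℕ → ℕ → ℕ) : ℕ :=
  ((Finset.range R) ×ˢ (Finset.range C)).sup fun p => T p.1 p.2

/-- Gromotion: delete the minimal entry (at the top-left corner), rectify by jeu de taquin
slides, and fill the vacated outer corner with (current maximum) + 1; entries are not
decremented. -/
def gromotion (R C : ℕ) (T : ℕ → ℕ → ℕ) : ℕ → ℕ → ℕ := fun i j =>
  if i = R - 1 ∧ j = C - 1 then maxEntry R C T + 1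
  else
    match (List.range (R + C - 2)).find? (fun k => decide (slidePath R C T k = (i, j))) with
    | some k => T (slidePath R C T (k + 1)).1 (slidePath R C T (k + 1)).2
    | none => T i j

/-- The entry that slides (up) into row `i` (1-indexed) during one gromotion slide of `T`:
the value of `T` at the first cell of the sliding path lying in 0-indexed row `i`. -/
def slideInto (R C : ℕ) (T : ℕ → ℕ → ℕ) (i : ℕ) : ℕ :=
  match (List.range (R + C - 1)).find? (fun k => decide ((slidePath R C T k).1 = i)) with
  | some k => T (slidePath R C T k).1 (slidePath R C T k).2
  | none => 0

/-- The `i`-th promotion permutation of `T ∈ SYT(R × C)`: its value at `j` is the entry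
that slides into row `i` when computing `gromotion^j(T)`, taken modulo `R*C` with
residues in `{1, …, R*C}`. -/
def promPerm (R C : ℕ) (T : ℕ → ℕ → ℕ) (i : ℕ) : ℕ → ℕ := fun j =>
  (slideInto R C ((gromotion R C)^[j - 1] T) i - 1) % (R * C) + 1

/-! ## Tableaux as lists of rows, Robinson–Schensted insertion -/

/-- Entry of a list-of-rows tableau (0-indexed; `0` outside). -/
def entryL (T : List (List ℕ)) (i j : ℕ) : ℕ := (T.getD i []).getD j 0

/-- Convert a function tableau on an `R × C` rectangle to a list of rows. -/
def toListT (R C : ℕ) (T : ℕ → ℕ → ℕ) : List (List ℕ) :=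
  (List.range R).map fun i => (List.range C).map fun j => T i j

/-- Transpose (conjugate) of a list-of-rows tableau. -/
def transposeT (T : List (List ℕ)) : List (List ℕ) :=
  (List.range (T.getD 0 []).length).map fun j => T.filterMap fun row => row[j]?

/-- Shape (row lengths) of a list-of-rows tableau. -/
def shapeL (T : List (List ℕ)) : List ℕ := T.map List.length

/-- Standard Young tableau, as a list of rows: weakly decreasing nonempty row lengths,
rows and columns strictly increasing, and entries exactly `{1, …, N}` where `N` is the
number of cells. -/
def IsSYTList (T : List (List ℕ)) : Prop :=
  (∀ i, i + 1 < T.length → (T.getD (i + 1) []).length ≤ (T.getD i []).length) ∧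
  (∀ row ∈ T, row ≠ []) ∧
  (∀ i j, i < T.length → j + 1 < (T.getD i []).length → entryL T i j < entryL T i (j + 1)) ∧
  (∀ i j, i + 1 < T.length → j < (T.getD (i + 1) []).length →
    entryL T i j < entryL T (i + 1) j) ∧
  T.flatten.Nodup ∧ (∀ m, m ∈ T.flatten ↔ 1 ≤ m ∧ m ≤ T.flatten.length)

/-- Schensted row insertion of `x` into a tableau. -/
def rowInsert : List (List ℕ) → ℕ → List (List ℕ)
  | [], x => [[x]]
  | r :: rs, x =>
    match r.dropWhile (fun y => decide (y < x)) with
    | [] => (r ++ [x]) :: rs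
    | y :: bs => (r.takeWhile (fun y => decide (y < x)) ++ x :: bs) :: rowInsert rs y

/-- The (0-indexed) row where the shape grew when passing from `P` to `P'`. -/
def rowOfNewCell (P P' : List (List ℕ)) : ℕ :=
  ((List.range P'.length).find? fun i =>
    decide ((P'.getD i []).length ≠ (P.getD i []).length)).getD 0

def placeInRow (Q : List (List ℕ)) (r k : ℕ) : List (List ℕ) :=
  if r < Q.length then Q.set r (Q.getD r [] ++ [k]) else Q ++ [[k]]

/-- The Robinson–Schensted correspondence: the pair (insertion tableau, recording tableau)
of a word. -/
def RS (w : List ℕ) : List (List ℕ) × List (List ℕ) :=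
  (List.range w.length).foldl
    (fun PQ i =>
      let P' := rowInsert PQ.1 (w.getD i 0)
      (P', placeInRow PQ.2 (rowOfNewCell PQ.1 P') (i + 1)))
    ([], [])

/-! ## Jeu de taquin on list tableaux; evacuation -/

def extL (T : List (List ℕ)) (p : ℕ × ℕ) : WithTop ℕ :=
  if p.2 < (T.getD p.1 []).length then ((entryL T p.1 p.2 : ℕ) : WithTop ℕ) else ⊤

def nextCellL (T : List (List ℕ)) (p : ℕ × ℕ) : ℕ × ℕ :=
  if extL T (p.1, p.2 + 1) = ⊤ ∧ extL T (p.1 + 1, p.2) = ⊤ then p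
  else if extL T (p.1, p.2 + 1) < extL T (p.1 + 1, p.2) then (p.1, p.2 + 1)
  else (p.1 + 1, p.2)

def jdtPath (T : List (List ℕ)) : ℕ → ℕ × ℕ
  | 0 => (0, 0)
  | k + 1 => nextCellL T (jdtPath T k)

/-- The outer corner vacated when the minimal entry of `T` is deleted and the tableau is
rectified by jeu de taquin slides. -/
def vacated (T : List (List ℕ)) : ℕ × ℕ := jdtPath T T.flatten.length

/-- The value at cell `(i, j)` after the rectification slide. -/
def slidValue (T : List (List ℕ)) (i j : ℕ) : ℕ :=
  match (List.range T.flatten.length).find? (fun k =>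
      decide (jdtPath T k = (i, j) ∧ jdtPath T (k + 1) ≠ (i, j))) with
  | some k => entryL T (jdtPath T (k + 1)).1 (jdtPath T (k + 1)).2
  | none => entryL T i j

/-- Delete the minimal entry of `T` and rectify. -/
def delta (T : List (List ℕ)) : List (List ℕ) :=
  ((List.range T.length).map fun i =>
    (List.range ((T.getD i []).length - if i = (vacated T).1 then 1 else 0)).map fun j =>
      slidValue T i j).filter fun row => decide (row ≠ [])

/-- The entry of the evacuation `∂T` at cell `(i,j)`: `n + 1 - k` where the `k`-th
deletion-rectification vacates `(i,j)`. -/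
def evacEntry (T : List (List ℕ)) (i j : ℕ) : ℕ :=
  match (List.range T.flatten.length).find? (fun k =>
      decide (vacated (delta^[k] T) = (i, j))) with
  | some k => T.flatten.length - k
  | none => 0

/-- Schützenberger evacuation `∂T` of a standard Young tableau. -/
def evacL (T : List (List ℕ)) : List (List ℕ) :=
  (List.range T.length).map fun i =>
    (List.range (T.getD i []).length).map fun j => evacEntry T i j

/-! ## Shadow lines, skeleta, and Viennot's construction -/

def dirNE (a b : ℤ × ℤ) : Prop := a.1 ≤ b.1 ∧ a.2 ≤ b.2
def dirSE (a b : ℤ × ℤ) : Prop := a.1 ≤ b.1 ∧ b.2 ≤ a.2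
def dirSW (a b : ℤ × ℤ) : Prop := b.1 ≤ a.1 ∧ b.2 ≤ a.2
def dirNW (a b : ℤ × ℤ) : Prop := b.1 ≤ a.1 ∧ a.2 ≤ b.2

def minimalsUnder (d : ℤ × ℤ → ℤ × ℤ → Prop) (P : Set (ℤ × ℤ)) : Set (ℤ × ℤ) :=
  {p ∈ P | ∀ q ∈ P, d q p → q = p}

/-- `P` minus its first `j` shadow lines. -/
def shadowRest (d : ℤ × ℤ → ℤ × ℤ → Prop) (P : Set (ℤ × ℤ)) : ℕ → Set (ℤ × ℤ)
  | 0 => P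
  | j + 1 => shadowRest d P j \ minimalsUnder d (shadowRest d P j)

/-- The `j`-th shadow line of `P` (1-indexed `j`). -/
def shadowLine (d : ℤ × ℤ → ℤ × ℤ → Prop) (P : Set (ℤ × ℤ)) (j : ℕ) : Set (ℤ × ℤ) :=
  minimalsUnder d (shadowRest d P (j - 1))

/-- The skeleton of a single shadow line `L`: the minimal elements of the set of points
covered by the shadows of at least two points of `L`. -/
def lineSkeleton (d : ℤ × ℤ → ℤ × ℤ → Prop) (L : Set (ℤ × ℤ)) : Set (ℤ × ℤ) :=
  minimalsUnder d {x | ∃ p ∈ L, ∃ q ∈ L, p ≠ q ∧ d p x ∧ d q x}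

/-- The skeleton of `P`: the union of the skeleta of its shadow lines. -/
def skeleton (d : ℤ × ℤ → ℤ × ℤ → Prop) (P : Set (ℤ × ℤ)) : Set (ℤ × ℤ) :=
  ⋃ j : ℕ, lineSkeleton d (shadowLine d P (j + 1))

/-- The `k`-th iterated skeleton of `P`. -/
def skeletonIter (d : ℤ × ℤ → ℤ × ℤ → Prop) (P : Set (ℤ × ℤ)) (k : ℕ) : Set (ℤ × ℤ) :=
  (skeleton d)^[k] P

def IsMinSnd (L : Set (ℤ × ℤ)) (y : ℤ) : Prop := (∃ p ∈ L, p.2 = y) ∧ ∀ p ∈ L, y ≤ p.2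
def IsMaxSnd (L : Set (ℤ × ℤ)) (y : ℤ) : Prop := (∃ p ∈ L, p.2 = y) ∧ ∀ p ∈ L, p.2 ≤ y
def IsMinFst (L : Set (ℤ × ℤ)) (x : ℤ) : Prop := (∃ p ∈ L, p.1 = x) ∧ ∀ p ∈ L, x ≤ p.1
def IsMaxFst (L : Set (ℤ × ℤ)) (x : ℤ) : Prop := (∃ p ∈ L, p.1 = x) ∧ ∀ p ∈ L, p.1 ≤ x

/-- The set of exit coordinates (specified by `spec`) of the shadow lines of the `i`-th
iterated skeleton of `P` in direction `d`. -/
def exitSet (spec : Set (ℤ × ℤ) → ℤ → Prop) (d : ℤ × ℤ → ℤ × ℤ → Prop)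
    (P : Set (ℤ × ℤ)) (i : ℕ) : Set ℤ :=
  {v | ∃ j : ℕ, spec (shadowLine d (skeletonIter d P i) (j + 1)) v}

/-- The word read off along one edge in Viennot's construction is the lattice word of the
standard tableau `T`: there is an enumeration `e` of all shadow-line exit coordinates,
in the order prescribed by `lt`, such that the `m`-th exit belongs to a shadow line of the
`i`-th iterated skeleton exactly when the entry `m` of `T` lies in row `i + 1`. -/
def ReadsWord (spec : Set (ℤ × ℤ) → ℤ → Prop) (lt : ℤ → ℤ → Prop)
    (d : ℤ × ℤ → ℤ × ℤ → Prop) (P : Set (ℤ × ℤ)) (T : List (List ℕ)) : Prop :=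
  ∃ e : Fin T.flatten.length → ℤ,
    (∀ a b : Fin T.flatten.length, a < b → lt (e a) (e b)) ∧
    (Set.range e = ⋃ i : ℕ, exitSet spec d P i) ∧
    ∀ (m : Fin T.flatten.length) (i : ℕ), e m ∈ exitSet spec d P i →
      (T.findIdx fun row => row.contains (m.1 + 1)) + 1 = i + 1

/-- `𝒱(𝒫, ↗) = (Pt, Qt)`: the P-word is read bottom-to-top along the right edge
(east exit heights, which are the minimal `y`-coordinates of the lines), the Q-word
left-to-right along the top edge (north exits at minimal `x`-coordinates). -/
def ViennotNE (P : Set (ℤ × ℤ)) (Pt Qt : List (List ℕ)) : Prop :=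
  ReadsWord IsMinSnd (· < ·) dirNE P Pt ∧ ReadsWord IsMinFst (· < ·) dirNE P Qt

/-- `𝒱(𝒫, ↘) = (Pt, Qt)`: P-word left-to-right along the bottom edge, Q-word
top-to-bottom along the right edge. -/
def ViennotSE (P : Set (ℤ × ℤ)) (Pt Qt : List (List ℕ)) : Prop :=
  ReadsWord IsMinFst (· < ·) dirSE P Pt ∧ ReadsWord IsMaxSnd (· > ·) dirSE P Qt

/-- `𝒱(𝒫, ↙) = (Pt, Qt)`: P-word bottom-to-top along the left edge, Q-word
right-to-left along the bottom edge. -/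
def ViennotSW (P : Set (ℤ × ℤ)) (Pt Qt : List (List ℕ)) : Prop :=
  ReadsWord IsMaxSnd (· < ·) dirSW P Pt ∧ ReadsWord IsMaxFst (· > ·) dirSW P Qt

/-- `𝒱(𝒫, ↖) = (Pt, Qt)`: P-word right-to-left along the top edge, Q-word
bottom-to-top along the left edge. -/
def ViennotNW (P : Set (ℤ × ℤ)) (Pt Qt : List (List ℕ)) : Prop :=
  ReadsWord IsMaxFst (· > ·) dirNW P Pt ∧ ReadsWord IsMinSnd (· < ·) dirNW P Qt

/-- The point set `𝒫^NE(ρ)` of the northeast `n × n` block of the permutation matrix of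
`ρ ∈ S_{2n}`, in Cartesian coordinates. -/
def pointsNE (n : ℕ) (f : ℕ → ℕ) : Set (ℤ × ℤ) :=
  {p | ∃ x : ℕ, 1 ≤ x ∧ x ≤ n ∧ n < f x ∧ p = ((f x : ℤ) - n, (n : ℤ) + 1 - x)}

/-! ## Crossings and nestings of perfect matchings -/

/-- The matching `{a, f a}` on `{1, …, N}` has a `k`-crossing:
blocks `{a₁ < b₁}, …, {a_k < b_k}` with `a₁ < ⋯ < a_k < b₁ < ⋯ < b_k`. -/
def HasCrossing (f : ℕ → ℕ) (N k : ℕ) : Prop :=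
  ∃ a b : Fin k → ℕ, StrictMono a ∧ StrictMono b ∧
    (∀ m, 1 ≤ a m ∧ b m ≤ N ∧ f (a m) = b m ∧ a m < b m) ∧
    ∀ m m' : Fin k, a m < b m'

/-- The matching `{a, f a}` on `{1, …, N}` has a `k`-nesting:
blocks `{a₁ < b₁}, …, {a_k < b_k}` with `a₁ < ⋯ < a_k < b_k < ⋯ < b₁`. -/
def HasNesting (f : ℕ → ℕ) (N k : ℕ) : Prop :=
  ∃ a b : Fin k → ℕ, StrictMono a ∧ StrictAnti b ∧
    (∀ m, 1 ≤ a m ∧ b m ≤ N ∧ f (a m) = b m ∧ a m < b m) ∧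
    ∀ m m' : Fin k, a m < b m'

/-! ## Local rules, the promotion–evacuation diagram, and the promotion matrix -/

/-- Partitions are encoded as lists of row lengths (fixed length, padded by zeros). -/
def sortDesc (l : List ℕ) : List ℕ := List.insertionSort (· ≥ ·) l

/-- The sequence `ν + κ - λ` (pointwise). -/
def ruleSeq (lam nu ka : List ℕ) : List ℕ :=
  List.zipWith (fun a b => a - b) (List.zipWith (· + ·) nu ka) lam

/-- The local rule: `μ = sort(ν + κ - λ)`. -/
def localRule (lam nu ka : List ℕ) : List ℕ := sortDesc (ruleSeq lam nu ka)

/-- The decoration of a local rule square: `i` if `ν + κ - λ` fails to be sorted at rows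
`i, i+1` (1-indexed), and `0` if no decoration is present. -/
def decoration (lam nu ka : List ℕ) : ℕ :=
  match (List.range (ruleSeq lam nu ka).length).find? (fun i =>
      decide ((ruleSeq lam nu ka).getD i 0 < (ruleSeq lam nu ka).getD (i + 1) 0)) with
  | some i => i + 1
  | none => 0

/-- Fill in the next row of the promotion–evacuation diagram from the previous row `prev`:
the new row starts with the empty partition at position `s` and continues by local rules. -/
def nextRow (R : ℕ) (prev : ℕ → List ℕ) (s : ℕ) : ℕ → List ℕ
  | 0 => List.replicate R 0
  | x + 1 =>
    if x + 1 ≤ s then List.replicate R 0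
    else localRule (prev x) (prev (x + 1)) (nextRow R prev s x)

/-- The `j`-th row of the promotion–evacuation diagram of `T ∈ SYT(R × C)`, as a function
of the column index (row `0` is the chain of `T`). -/
def PErow (R C : ℕ) (T : ℕ → ℕ → ℕ) : ℕ → ℕ → List ℕ
  | 0 => fun x => (List.range R).map fun i =>
      ((Finset.range C).filter fun j => T i j ≤ min x (R * C)).card
  | j + 1 => nextRow R (PErow R C T j) (j + 1)

/-- For `S = stack(P, Q) ∈ SYT(2r × c)` and `n = r*c`, the `(n+1) × (n+1)` northeast block
of partitions `λ(x, y)` of `PEdiagram(S)` (Cartesian coordinates): `λ(x,y)` is the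
diagram entry in row `n - y`, column `n + x`. -/
def lamBlock (r c : ℕ) (S : ℕ → ℕ → ℕ) (x y : ℕ) : List ℕ :=
  PErow (2 * r) c S (r * c - y) (r * c + x)

/-- The entry of `PM(S)^NE` at Cartesian coordinates `(x, y)`, `1 ≤ x, y ≤ n`: the
decoration of the local rule square with corners `λ(x-1, y-1)`, `λ(x-1, y)`, `λ(x, y-1)`,
`λ(x, y)`. -/
def PMNE (r c : ℕ) (S : ℕ → ℕ → ℕ) (x y : ℕ) : ℕ :=
  decoration (lamBlock r c S (x - 1) y) (lamBlock r c S x y) (lamBlock r c S (x - 1) (y - 1))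

/-- Chain of partitions of a list tableau: shape of the entries `≤ m`. -/
def chainOfL (T : List (List ℕ)) (m : ℕ) : List ℕ :=
  T.map fun row => (row.filter fun a => decide (a ≤ m)).length

/-- Column height `#{i : j < l i}` of a partition. -/
def colHeight (l : List ℕ) (j : ℕ) : ℕ := (l.filter fun a => decide (j < a)).length

/-- Vertical sum `l +' m` of two partitions (stack the columns of `m` onto those of `l`),
computed inside a `rows × cols` bounding box. -/
def vsum (rows cols : ℕ) (l m : List ℕ) : List ℕ :=
  (List.range rows).map fun i =>
    ((List.range cols).filter fun j => decide (i < colHeight l j + colHeight m j)).length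

/-! ## The point sets `S_k` and `S_{kj}` -/

/-- `x_{sj}`: the entry of `Q` in row `s`, column `j` (1-indexed). -/
def xEnt (Q : ℕ → ℕ → ℕ) (s j : ℕ) : ℤ := (Q (s - 1) (j - 1) : ℤ)

/-- `y_{tj}`: the entry of `∂(P)` in row `t`, column `j` (1-indexed). -/
def yEnt (r c : ℕ) (P : ℕ → ℕ → ℕ) (t j : ℕ) : ℤ :=
  (entryL (evacL (toListT r c P)) (t - 1) (j - 1) : ℤ)

def Skj (r c : ℕ) (P Q : ℕ → ℕ → ℕ) (k j : ℕ) : Set (ℤ × ℤ) :=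
  {p | ∃ s t : ℕ, 1 ≤ s ∧ s ≤ r ∧ 1 ≤ t ∧ t ≤ r ∧ s + t - 1 = k ∧
    p = (xEnt Q s j, yEnt r c P t j)}

def Sk (r c : ℕ) (P Q : ℕ → ℕ → ℕ) (k : ℕ) : Set (ℤ × ℤ) :=
  ⋃ j ∈ Set.Icc 1 c, Skj r c P Q k j

/-- A southeast chain of `k` ones in the matrix `U` (rows increase, columns increase),
contained in a rectangle that fully fits into the strictly upper triangular part of the
`N × N` matrix. -/
def HasSEChain (U : ℕ → ℕ → ℕ) (N k : ℕ) : Prop :=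
  ∃ a b : Fin k → ℕ, StrictMono a ∧ StrictMono b ∧ (∀ m, U (a m) (b m) = 1) ∧
    ∃ r₁ r₂ c₁ c₂ : ℕ, 1 ≤ r₁ ∧ r₂ < c₁ ∧ c₂ ≤ N ∧
      ∀ m, r₁ ≤ a m ∧ a m ≤ r₂ ∧ c₁ ≤ b m ∧ b m ≤ c₂

/-- A southwest chain of `k` ones in the matrix `U` (rows increase, columns decrease),
contained in a rectangle that fully fits into the strictly upper triangular part of the
`N × N` matrix. -/
def HasSWChain (U : ℕ → ℕ → ℕ) (N k : ℕ) : Prop :=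
  ∃ a b : Fin k → ℕ, StrictMono a ∧ StrictAnti b ∧ (∀ m, U (a m) (b m) = 1) ∧
    ∃ r₁ r₂ c₁ c₂ : ℕ, 1 ≤ r₁ ∧ r₂ < c₁ ∧ c₂ ≤ N ∧
      ∀ m, r₁ ≤ a m ∧ a m ≤ r₂ ∧ c₁ ≤ b m ∧ b m ≤ c₂

/-! ## Insertion into Gelfand–Tsetlin patterns -/

/-- Add one box to row `a` of the shape `f`. -/
def inc (f : ℕ → ℕ) (a : ℕ) : ℕ → ℕ := fun x => if x = a then f x + 1 else f x

theorem inc_apply (f : ℕ → ℕ) (a x : ℕ) : inc f a x = if x = a then f x + 1 else f x := rfl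

theorem inc_comm (f : ℕ → ℕ) (a b : ℕ) : inc (inc f a) b = inc (inc f b) a := by
  funext x; simp only [inc_apply]; split_ifs <;> rfl

theorem inc_left_injective {f : ℕ → ℕ} {a b : ℕ} (h : inc f a = inc f b) : a = b := by
  have := congrFun h a
  simp only [inc_apply] at this
  split_ifs at this <;> omega

/-- Row `a` of the shape `f` can be extended by a box. -/
def Addable (f : ℕ → ℕ) (a : ℕ) : Prop := a = 0 ∨ f a < f (a - 1)

/-- Jeu de taquin local rule, in terms of the rows of the added boxes: the shape `k` grows to
`inc k p` and `inc k q`, and both grow to the same shape by boxes in rows `q'` and `p'`. -/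
def LocalRule (k : ℕ → ℕ) (p q p' q' : ℕ) : Prop :=
  (p ≠ q ∧ p' = p ∧ q' = q) ∨ (p = q ∧ p' = q' ∧ (q' = p ∨ (q' = p + 1 ∧ k (p + 1) = k p)))

theorem LocalRule.inc_inc {k : ℕ → ℕ} {p q p' q' : ℕ} (h : LocalRule k p q p' q') :
    inc (inc k p) q' = inc (inc k q) p' := by
  rcases h with ⟨_, rfl, rfl⟩ | ⟨rfl, rfl, _⟩
  · exact inc_comm _ _ _
  · rfl

/-- The local rule determines the box `q` from the boxes `p` and `q'`. -/
theorem LocalRule.unique {k : ℕ → ℕ} {p q p' q' s s' : ℕ} (h : LocalRule k p q p' q')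
    (h' : LocalRule k p s s' q') (hq : Addable k q) (hs : Addable k s) : q = s := by
  unfold LocalRule Addable at *
  grind

/-- The shape `l` is obtained from `g` by adding a horizontal strip. -/
def Interlace (g l : ℕ → ℕ) : Prop := ∀ a, l (a + 1) ≤ g a ∧ g a ≤ l a

/-- The lowest row weakly above row `a` where `l` can grow while keeping the skew
shape over `g` a horizontal strip. -/
def low (g l : ℕ → ℕ) : ℕ → ℕ
  | 0 => 0
  | a + 1 => if l (a + 1) < g a then a + 1 else low g l a

theorem low_spec (g l : ℕ → ℕ) (a : ℕ) : low g l a ≤ a ∧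
    (low g l a = 0 ∨ l (low g l a) < g (low g l a - 1)) ∧
    ∀ t, low g l a < t → t ≤ a → g (t - 1) ≤ l t := by
  induction a with
  | zero => exact ⟨le_rfl, Or.inl rfl, fun t h1 h2 => by omega⟩
  | succ a ih =>
    unfold low
    split_ifs with h
    · exact ⟨le_rfl, Or.inr h, fun t h1 h2 => by omega⟩
    · refine ⟨by omega, ih.2.1, fun t h1 h2 => ?_⟩
      rcases Nat.lt_or_ge t (a + 1) with h3 | h3
      · exact ih.2.2 t h1 (by omega)
      · obtain rfl : t = a + 1 := by omega
        simpa using h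

theorem low_eq {g l : ℕ → ℕ} {a b : ℕ} (hb : b ≤ a) (h0 : b = 0 ∨ l b < g (b - 1))
    (h : ∀ t, b < t → t ≤ a → g (t - 1) ≤ l t) : low g l a = b := by
  obtain ⟨h1, h2, h3⟩ := low_spec g l a
  by_contra hne
  rcases Nat.lt_or_gt_of_ne hne with h4 | h4
  · have := h3 b h4 hb
    omega
  · have := h _ h4 h1
    omega

/-- The row reached one level higher by a box in row `p` during left insertion. -/
def shift (g l : ℕ → ℕ) (p : ℕ) : ℕ := if g p < l p then p + 1 else p

theorem shift_of_lt {g l : ℕ → ℕ} {p : ℕ} (h : g p < l p) : shift g l p = p + 1 := if_pos h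

theorem shift_of_not_lt {g l : ℕ → ℕ} {p : ℕ} (h : ¬g p < l p) : shift g l p = p := if_neg h

theorem low_inc_inc (g l : ℕ → ℕ) (p q : ℕ) : low (inc g p) (inc l (p + 1)) q = low g l q := by
  induction q with
  | zero => rfl
  | succ q ih =>
    have : inc l (p + 1) (q + 1) < inc g p q ↔ l (q + 1) < g q := by
      simp only [inc_apply]; split_ifs <;> omega
    simp only [low, ih, this]

theorem localRule_succ {g l : ℕ → ℕ} {p q p' q' : ℕ} (hgl : Interlace g l)
    (h : LocalRule g p q p' q') (hp : Addable g p) (hq : p = q → Addable (inc g p) q') :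
    LocalRule l (shift g l p) (low g l q) (shift (inc g q) (inc l (low g l q)) p')
      (low (inc g p) (inc l (shift g l p)) q') := by
  obtain ⟨a1, a2, a3⟩ := low_spec g l q
  generalize hQ : low g l q = Q at *
  have i1 := hgl p
  have i2 := hgl (p + 1)
  have c1 := a3 p
  have c2 := a3 (p + 1)
  unfold Addable at hp hq
  rcases h with ⟨hne, rfl, rfl⟩ | ⟨rfl, rfl, h⟩
  · by_cases hlt : g p' < l p'
    · rw [shift_of_lt hlt, low_inc_inc, hQ, shift_of_lt]
      · unfold LocalRule; omega
      · simp only [inc_apply, if_neg hne]; split_ifs <;> omega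
    · rw [shift_of_not_lt hlt]
      by_cases hQp : Q = p'
      · subst hQp
        rw [shift_of_lt, low_eq (b := Q + 1)]
        · unfold LocalRule; simp only [Nat.add_sub_cancel] at c2; omega
        · omega
        · simp [inc_apply]; omega
        · intro t h1 h2
          have := a3 t (by omega) h2
          simp only [inc_apply]; split_ifs <;> omega
        · simp only [inc_apply, if_neg hne]; simp; omega
      · rw [shift_of_not_lt, low_eq (b := Q)]
        · unfold LocalRule; omega
        · omega
        · simp only [inc_apply]; split_ifs <;> omega
        · intro t h1 h2
          have := a3 t (by omega) h2
          simp only [inc_apply]; split_ifs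
          · omega
          · omega
          · exfalso
            obtain rfl : t = p' + 1 := by omega
            omega
          · omega
        · simp only [inc_apply, if_neg hne, if_neg (Ne.symm hQp)]; omega
  · have hq := hq rfl
    simp only [inc_apply] at hq
    by_cases hlt : g p < l p
    · rw [shift_of_lt hlt, low_inc_inc]
      rcases h with rfl | ⟨rfl, h⟩
      · rw [hQ, shift_of_lt]
        · unfold LocalRule; omega
        · simp only [inc_apply]; split_ifs at * <;> omega
      · rw [low, hQ, if_neg (by omega), shift_of_not_lt]
        · unfold LocalRule; omega
        · simp only [inc_apply]; split_ifs <;> omega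
    · rw [shift_of_not_lt hlt]
      obtain rfl : Q = p := by omega
      rcases h with rfl | ⟨rfl, h⟩
      · rw [shift_of_not_lt, low_eq le_rfl]
        · unfold LocalRule; omega
        · simp only [inc_apply]; split_ifs at * <;> omega
        · omega
        · simp only [inc_apply]; split_ifs <;> omega
      · rw [shift_of_not_lt, low_eq (b := Q + 1)]
        · unfold LocalRule; omega
        · omega
        · simp [inc_apply]; omega
        · omega
        · simp [inc_apply]; omega

/-- A Gelfand–Tsetlin pattern: consecutive levels differ by horizontal strips. -/
def IsGT (X : ℕ → ℕ → ℕ) : Prop := ∀ m, Interlace (X m) (X (m + 1))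

/-- The row in which level `m` of `X` grows when the letter `b` is inserted from the right
(meaningful for `b < m`; below that it is the letter itself). -/
def bumpRow (X : ℕ → ℕ → ℕ) (b : ℕ) : ℕ → ℕ
  | 0 => b
  | m + 1 => if m < b then b else low (X m) (X (m + 1)) (bumpRow X b m)

/-- Insert the letter `b` from the right. -/
def rins (X : ℕ → ℕ → ℕ) (b : ℕ) : ℕ → ℕ → ℕ :=
  fun m => if b < m then inc (X m) (bumpRow X b m) else X m

/-- The row in which level `m` of `X` grows when the letter `h` is inserted from the left. -/
def leftRow (X : ℕ → ℕ → ℕ) (h : ℕ) : ℕ → ℕ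
  | 0 => 0
  | m + 1 => if m ≤ h then 0 else shift (X m) (X (m + 1)) (leftRow X h m)

/-- Insert the letter `h` from the left. -/
def lins (X : ℕ → ℕ → ℕ) (h : ℕ) : ℕ → ℕ → ℕ :=
  fun m => if h < m then inc (X m) (leftRow X h m) else X m

section Insertion

variable {X : ℕ → ℕ → ℕ}

theorem bumpRow_of_le {b m : ℕ} (h : m ≤ b) : bumpRow X b m = b := by
  cases m with
  | zero => rfl
  | succ m => exact if_pos h

theorem bumpRow_succ {b m : ℕ} (h : b ≤ m) :
    bumpRow X b (m + 1) = low (X m) (X (m + 1)) (bumpRow X b m) := if_neg (by omega)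

theorem rins_of_lt {b m : ℕ} (h : b < m) : rins X b m = inc (X m) (bumpRow X b m) := if_pos h

theorem rins_of_le {b m : ℕ} (h : m ≤ b) : rins X b m = X m := if_neg (by omega)

theorem leftRow_of_le {b m : ℕ} (h : m ≤ b + 1) : leftRow X b m = 0 := by
  cases m with
  | zero => rfl
  | succ m => exact if_pos (by omega)

theorem leftRow_succ {b m : ℕ} (h : b < m) :
    leftRow X b (m + 1) = shift (X m) (X (m + 1)) (leftRow X b m) := if_neg (by omega)

theorem lins_of_lt {b m : ℕ} (h : b < m) : lins X b m = inc (X m) (leftRow X b m) := if_pos h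

theorem lins_of_le {b m : ℕ} (h : m ≤ b) : lins X b m = X m := if_neg (by omega)

theorem leftRow_lt {b m : ℕ} (h : b < m) : leftRow X b m < m := by
  induction m with
  | zero => omega
  | succ m ih =>
    rcases Nat.lt_or_ge b m with h' | h'
    · have := ih h'
      rw [leftRow_succ h', shift]
      split_ifs <;> omega
    · rw [leftRow_of_le (by omega)]
      omega

theorem IsGT.addable_bumpRow (hX : IsGT X) {b m : ℕ} (h : b < m) :
    Addable (X m) (bumpRow X b m) := by
  cases m with
  | zero => omega
  | succ m =>
    rw [bumpRow_succ (by omega)]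
    rcases (low_spec (X m) (X (m + 1)) (bumpRow X b m)).2.1 with h1 | h1
    · exact Or.inl h1
    · exact Or.inr (h1.trans_le (hX m _).2)

theorem IsGT.addable_leftRow (hX : IsGT X) (b m : ℕ) : Addable (X m) (leftRow X b m) := by
  induction m with
  | zero => exact Or.inl rfl
  | succ m ih =>
    rcases Nat.lt_or_ge b m with h' | h'
    · rw [leftRow_succ h']
      unfold Addable at *
      have h1 := hX m (leftRow X b m)
      have h2 := hX m (leftRow X b m - 1)
      by_cases h : X m (leftRow X b m) < X (m + 1) (leftRow X b m)
      · rw [shift_of_lt h]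
        simp only [Nat.add_sub_cancel]
        omega
      · rw [shift_of_not_lt h]
        omega
    · exact Or.inl (leftRow_of_le (by omega))

theorem IsGT.rins (hX : IsGT X) (b : ℕ) : IsGT (rins X b) := by
  intro m a
  obtain ⟨h1, h2⟩ := hX m a
  rcases Nat.lt_or_ge m b with h | h
  · rw [rins_of_le h, rins_of_le h.le]
    exact ⟨h1, h2⟩
  · rw [rins_of_lt (by omega : b < m + 1), bumpRow_succ h]
    obtain ⟨a1, a2, a3⟩ := low_spec (X m) (X (m + 1)) (bumpRow X b m)
    have a3 := a3 (bumpRow X b m)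
    generalize low (X m) (X (m + 1)) (bumpRow X b m) = Q at *
    rcases Nat.lt_or_ge b m with h' | h'
    · rw [rins_of_lt h']
      have h4 := hX.addable_bumpRow h'
      generalize bumpRow X b m = q at *
      unfold Addable at h4
      simp only [inc_apply]
      constructor
      · split_ifs with c1 c2
        · omega
        · subst c1; simp only [Nat.add_sub_cancel] at a2; omega
        · omega
        · omega
      · split_ifs with c1 c2 <;> try omega
        subst c1
        omega
    · rw [rins_of_le h']
      simp only [inc_apply]
      constructor
      · split_ifs with c1
        · subst c1; simp only [Nat.add_sub_cancel] at a2; omega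
        · omega
      · split_ifs <;> omega

theorem IsGT.lins (hX : IsGT X) (b : ℕ) : IsGT (lins X b) := by
  intro m a
  obtain ⟨h1, h2⟩ := hX m a
  rcases Nat.lt_or_ge m b with h | h
  · rw [lins_of_le h, lins_of_le h.le]
    exact ⟨h1, h2⟩
  · rw [lins_of_lt (by omega : b < m + 1)]
    rcases Nat.lt_or_ge b m with h' | h'
    · rw [leftRow_succ h', lins_of_lt h']
      have h4 := hX.addable_leftRow b m
      have h5 := hX m (leftRow X b m)
      generalize leftRow X b m = q at *
      unfold Addable at h4
      by_cases hlt : X m q < X (m + 1) q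
      · rw [shift_of_lt hlt]
        simp only [inc_apply]
        constructor
        · split_ifs <;> omega
        · split_ifs with c1 c2 <;> try omega
          subst c1
          omega
      · rw [shift_of_not_lt hlt]
        simp only [inc_apply]
        constructor
        · split_ifs with c1 c2 <;> try omega
          subst c1
          simp only [Nat.add_sub_cancel] at h4
          omega
        · split_ifs <;> omega
    · rw [leftRow_of_le (by omega), lins_of_le h']
      simp only [inc_apply]
      constructor
      · rw [if_neg (by omega)]; exact h1
      · split_ifs <;> omega

theorem low_inc_zero (g l : ℕ → ℕ) (q : ℕ) : low g (inc l 0) q = low g l q := by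
  induction q with
  | zero => rfl
  | succ q ih => simp [low, ih, inc_apply]

/-- Inserting from the left and inserting from the right commute up to the local rule. -/
theorem IsGT.localRule_ins (hX : IsGT X) (h e m : ℕ) :
    (h < m → LocalRule (X m) (leftRow X h m) (bumpRow X e m)
      (leftRow (PromRS.rins X e) h m) (bumpRow (PromRS.lins X h) e m)) ∧
    (m ≤ h → bumpRow (PromRS.lins X h) e m = bumpRow X e m) := by
  induction m with
  | zero => exact ⟨fun h => absurd h (by omega), fun _ => rfl⟩
  | succ m ih =>
    refine ⟨fun hm => ?_, fun hm => ?_⟩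
    · have hlt := leftRow_lt (X := X) hm
      rcases Nat.lt_or_ge m e with he | he
      · rw [bumpRow_of_le he, bumpRow_of_le he]
        refine Or.inl ⟨by omega, ?_, rfl⟩
        rcases Nat.lt_or_ge h m with hm' | hm'
        · rw [leftRow_succ hm', leftRow_succ hm', rins_of_le he, rins_of_le he.le]
          have h1 := ih.1 hm'
          have := leftRow_lt (X := X) hm'
          rw [bumpRow_of_le he.le, bumpRow_of_le he.le] at h1
          unfold LocalRule at h1
          congr 1
          omega
        · rw [leftRow_of_le (by omega), leftRow_of_le (by omega)]
      · rw [bumpRow_succ he, bumpRow_succ he, lins_of_lt hm]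
        rcases Nat.lt_or_ge h m with hm' | hm'
        · have h1 := ih.1 hm'
          have h2 := localRule_succ (hX m) h1 (hX.addable_leftRow h m) (fun hp => by
            rw [← lins_of_lt hm']
            apply (hX.lins h).addable_bumpRow
            by_contra hc
            rw [bumpRow_of_le (by omega)] at hp
            have := leftRow_lt (X := X) hm'
            omega)
          rw [leftRow_succ hm', leftRow_succ hm', rins_of_lt (by omega : e < m + 1),
            lins_of_lt hm', bumpRow_succ he]
          rcases Nat.lt_or_ge e m with he' | he'
          · rw [rins_of_lt he']
            exact h2
          · rw [rins_of_le he']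
            obtain rfl : e = m := by omega
            have := leftRow_lt (X := X) hm'
            have h3 : leftRow (PromRS.rins X e) h e = leftRow X h e := by
              rw [bumpRow_of_le le_rfl, bumpRow_of_le le_rfl] at h1
              unfold LocalRule at h1
              omega
            convert h2 using 1
            rw [h3, bumpRow_of_le le_rfl, shift, shift]
            simp only [inc_apply, if_neg this.ne]
            split_ifs <;> rfl
        · obtain rfl : h = m := by omega
          rw [leftRow_of_le le_rfl, leftRow_of_le le_rfl, lins_of_le le_rfl, ih.2 le_rfl,
            low_inc_zero]
          unfold LocalRule
          omega
    · rcases Nat.lt_or_ge m e with he | he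
      · rw [bumpRow_of_le he, bumpRow_of_le he]
      · rw [bumpRow_succ he, bumpRow_succ he, lins_of_le hm, lins_of_le (by omega),
          ih.2 (by omega)]

theorem IsGT.rins_lins (hX : IsGT X) (h e : ℕ) :
    PromRS.rins (PromRS.lins X h) e = PromRS.lins (PromRS.rins X e) h := by
  funext m
  obtain ⟨h1, h2⟩ := hX.localRule_ins h e m
  rcases Nat.lt_or_ge h m with hm | hm <;> rcases Nat.lt_or_ge e m with he | he
  · rw [rins_of_lt he, lins_of_lt hm, lins_of_lt hm, rins_of_lt he]
    exact (h1 hm).inc_inc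
  · rw [rins_of_le he, lins_of_lt hm, lins_of_lt hm, rins_of_le he]
    have h1 := h1 hm
    have := leftRow_lt (X := X) hm
    rw [bumpRow_of_le he, bumpRow_of_le he] at h1
    unfold LocalRule at h1
    congr 1
    omega
  · rw [rins_of_lt he, lins_of_le hm, lins_of_le hm, rins_of_lt he, h2 hm]
  · rw [rins_of_le he, lins_of_le hm, lins_of_le hm, rins_of_le he]

end Insertion

/-! ## Growth diagrams -/

/-- The pattern obtained by inserting the letters `w i, …, w (i + l - 1)`. -/
def pat (w : ℕ → ℕ) (i : ℕ) : ℕ → ℕ → ℕ → ℕ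
  | 0 => fun _ _ => 0
  | l + 1 => rins (pat w i l) (w (i + l))

theorem isGT_pat (w : ℕ → ℕ) (i l : ℕ) : IsGT (pat w i l) := by
  induction l with
  | zero => exact fun m a => ⟨le_rfl, le_rfl⟩
  | succ l ih => exact ih.rins _

theorem low_zero (q : ℕ) : low (fun _ => 0) (fun _ => 0) q = 0 := by
  induction q with
  | zero => rfl
  | succ q ih => simp [low, ih]

theorem rins_zero (b : ℕ) : rins (fun _ _ => 0) b = lins (fun _ _ => 0) b := by
  funext m
  rcases Nat.lt_or_ge b m with h | h
  · rw [rins_of_lt h, lins_of_lt h]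
    congr 1
    have h1 : ∀ m, leftRow (fun _ _ => 0) b m = 0 := by
      intro m
      induction m with
      | zero => rfl
      | succ m ih => simp [leftRow, ih, shift]
    rw [h1]
    cases m with
    | zero => omega
    | succ m => rw [bumpRow_succ (by omega), low_zero]
  · rw [rins_of_le h, lins_of_le h]

theorem pat_succ_left (w : ℕ → ℕ) (i l : ℕ) :
    pat w i (l + 1) = lins (pat w (i + 1) l) (w i) := by
  induction l with
  | zero => exact rins_zero _
  | succ l ih =>
    rw [pat, ih, (isGT_pat w (i + 1) l).rins_lins, pat]
    congr 3
    omega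

/-- For a lattice word, inserting from the beginning yields the content at each level. -/
theorem pat_zero_eq {w : ℕ → ℕ} {f : ℕ → ℕ → ℕ} {N : ℕ} (h0 : f 0 = fun _ => 0)
    (hs : ∀ l < N, f (l + 1) = inc (f l) (w l)) (ha : ∀ l < N, Addable (f l) (w l))
    {l : ℕ} (hl : l ≤ N) (m a : ℕ) : pat w 0 l m a = if a < m then f l a else 0 := by
  induction l generalizing m a with
  | zero => simp [pat, h0]
  | succ l ih =>
    have ih := fun m a => ih (by omega) m a
    have ha := ha l (by omega)
    rw [hs l (by omega), pat, zero_add]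
    have hb : ∀ m, bumpRow (pat w 0 l) (w l) m = w l := by
      intro m
      induction m with
      | zero => rfl
      | succ m ihm =>
        rcases Nat.lt_or_ge m (w l) with h | h
        · exact bumpRow_of_le h
        · rw [bumpRow_succ h, ihm]
          refine low_eq le_rfl ?_ (fun t _ _ => by omega)
          rcases ha with ha | ha
          · exact Or.inl ha
          · rcases Nat.eq_zero_or_pos (w l) with h' | h'
            · exact Or.inl h'
            · right
              rw [ih, ih, if_pos (by omega), if_pos (by omega)]
              exact ha
    rcases Nat.lt_or_ge (w l) m with h | h
    · rw [rins_of_lt h, hb, inc_apply, inc_apply, ih]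
      split_ifs <;> omega
    · rw [rins_of_le h, ih, inc_apply]
      split_ifs <;> omega

/-- For a balanced lattice word, inserting from the end yields the complemented content. -/
theorem pat_end_eq {w : ℕ → ℕ} {f : ℕ → ℕ → ℕ} {N R C : ℕ}
    (hs : ∀ l < N, f (l + 1) = inc (f l) (w l)) (ha : ∀ l ≤ N, ∀ a, f l (a + 1) ≤ f l a)
    (hN : ∀ a < R, f N a = C) (hC : ∀ l ≤ N, ∀ a, f l a ≤ C)
    {i l : ℕ} (hl : i + l = N) {m : ℕ} (hm : m ≤ R) (a : ℕ) :
    pat w i l m a = if a < m then C - f i (m - 1 - a) else 0 := by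
  induction l generalizing i m a with
  | zero =>
    obtain rfl : i = N := hl
    simp only [pat]
    split_ifs
    · rw [hN _ (by omega), Nat.sub_self]
    · rfl
  | succ l ih =>
    have ih := fun m hm a => ih (i := i + 1) (by omega) (m := m) hm a
    have hb : ∀ m ≤ R, w i < m → leftRow (pat w (i + 1) l) (w i) m = m - 1 - w i := by
      intro m hm
      induction m with
      | zero => omega
      | succ m ihm =>
        intro hlt
        rcases Nat.lt_or_ge (w i) m with h | h
        · rw [leftRow_succ h, ihm (by omega) h, shift_of_lt]
          · omega
          · rw [ih _ (by omega), ih _ (by omega), if_pos (by omega), if_pos (by omega)]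
            have h1 : m - 1 - (m - 1 - w i) = w i := by omega
            have h2 : m + 1 - 1 - (m - 1 - w i) = w i + 1 := by omega
            have h3 := hC (i + 1) (by omega) (w i)
            have h4 := ha i (by omega) (w i)
            rw [h1, h2]
            rw [hs i (by omega)] at h3 ⊢
            simp only [inc_apply] at h3 ⊢
            simp at h3 ⊢
            omega
        · rw [leftRow_of_le (by omega)]
          omega
    rw [pat_succ_left]
    have h3 := hC (i + 1) (by omega) (w i)
    have h4 := ih m hm a
    rw [hs i (by omega)] at h3 h4
    simp only [inc_apply] at h3 h4
    rcases Nat.lt_or_ge (w i) m with h | h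
    · rw [lins_of_lt h, hb m hm h, inc_apply, h4]
      split_ifs at * with c1 c2 c3 <;> try omega
      rw [c3]
      omega
    · rw [lins_of_le h, h4]
      split_ifs <;> omega

/-- A family of shapes `L i j` (`i ≤ j ≤ i + N`), each growing one box at a time, related by
the local rule and reaching the `R × C` rectangle at `j = i + N`. -/
structure GrowthDiagram (R C N : ℕ) (L : ℕ → ℕ → ℕ → ℕ) : Prop where
  diag : ∀ i, L i i = fun _ => 0
  zero : ∀ i j a, R ≤ a → L i j a = 0
  anti : ∀ i j a, L i j (a + 1) ≤ L i j a
  full : ∀ i a, a < R → L i (i + N) a = C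
  step : ∀ i j, i ≤ j → j < i + N → ∃ q, L i (j + 1) = inc (L i j) q
  square : ∀ i j, i < j → j < i + N → ∃ p q p' q', L i j = inc (L (i + 1) j) p ∧
    L i (j + 1) = inc (L i j) q' ∧ L (i + 1) (j + 1) = inc (L (i + 1) j) q ∧
    LocalRule (L (i + 1) j) p q p' q'

namespace GrowthDiagram

variable {R C N : ℕ} {L : ℕ → ℕ → ℕ → ℕ}

theorem translate (hL : GrowthDiagram R C N L) (s : ℕ) :
    GrowthDiagram R C N fun i j => L (s + i) (s + j) where
  diag i := hL.diag _
  zero i j := hL.zero _ _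
  anti i j := hL.anti _ _
  full i a ha := by
    rw [← Nat.add_assoc]
    exact hL.full _ a ha
  step i j h1 h2 := hL.step (s + i) (s + j) (by omega) (by omega)
  square i j h1 h2 := hL.square (s + i) (s + j) (by omega) (by omega)

theorem addable (hL : GrowthDiagram R C N L) {i j q : ℕ} {k : ℕ → ℕ} (h : L i j = inc k q) :
    Addable k q := by
  rcases Nat.eq_zero_or_pos q with h0 | h0
  · exact Or.inl h0
  · right
    have := hL.anti i j (q - 1)
    rw [h, Nat.sub_add_cancel h0, inc_apply, inc_apply, if_pos rfl, if_neg (by omega)] at this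
    omega

theorem row_lt (hL : GrowthDiagram R C N L) {i j q : ℕ} {k : ℕ → ℕ} (h : L i j = inc k q) :
    q < R := by
  by_contra hc
  have := hL.zero i j q (by omega)
  rw [h, inc_apply, if_pos rfl] at this
  omega

theorem mono (hL : GrowthDiagram R C N L) {i j k : ℕ} (hij : i ≤ j) (hjk : j ≤ k)
    (hk : k ≤ i + N) (a : ℕ) : L i j a ≤ L i k a := by
  induction k, hjk using Nat.le_induction with
  | base => exact le_rfl
  | succ k hjk ih =>
    obtain ⟨q, hq⟩ := hL.step i k (by omega) (by omega)
    have := ih (by omega)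
    rw [hq, inc_apply]
    split_ifs <;> omega

theorem le (hL : GrowthDiagram R C N L) {i j : ℕ} (hij : i ≤ j) (hj : j ≤ i + N) (a : ℕ) :
    L i j a ≤ C := by
  rcases Nat.lt_or_ge a R with h | h
  · exact (hL.mono hij hj le_rfl a).trans (hL.full i a h).le
  · rw [hL.zero i j a h]
    exact Nat.zero_le _

theorem eq_pat (hL : GrowthDiagram R C N L) {w : ℕ → ℕ}
    (hw : ∀ l < N, L 0 (l + 1) = inc (L 0 l) (w l)) {i l : ℕ} (hl : i + l ≤ N) :
    L i (i + l) = pat w i l R := by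
  have hwR : ∀ l < N, w l < R := fun l h => hL.row_lt (hw l h)
  induction i generalizing l with
  | zero =>
    funext a
    rw [zero_add, pat_zero_eq (hL.diag 0) hw (fun l h => hL.addable (hw l h)) (by omega)]
    split_ifs with h
    · rfl
    · exact hL.zero _ _ _ (by omega)
  | succ i ihi =>
    induction l with
    | zero => exact hL.diag _
    | succ l ih =>
      have e1 := ih (by omega)
      have e2 := ihi (l := l + 1) (by omega)
      have e3 := ihi (l := l + 2) (by omega)
      obtain ⟨p, q, p', q', s1, s2, s3, s4⟩ := hL.square i (i + 1 + l) (by omega) (by omega)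
      have hwi := hwR i (by omega)
      have hwl := hwR (i + 1 + l) (by omega)
      have sq := ((isGT_pat w (i + 1) l).localRule_ins (w i) (w (i + 1 + l)) R).1 hwi
      have e4 : pat w i (l + 2) = rins (pat w i (l + 1)) (w (i + 1 + l)) := by
        rw [pat]; congr 2; omega
      rw [pat_succ_left w i l] at e2 e4
      rw [lins_of_lt hwi] at e2
      rw [e4, rins_of_lt hwl, lins_of_lt hwi] at e3
      have e5 : i + (l + 1) = i + 1 + l := by omega
      rw [e5] at e2
      have e6 : i + (l + 2) = i + 1 + l + 1 := by omega
      rw [e6] at e3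
      rw [e1] at s1 s3 s4
      have hp := inc_left_injective (s1.symm.trans e2)
      rw [s2, e2] at e3
      have hq' := inc_left_injective e3
      subst hp hq'
      have hq := s4.unique sq (hL.addable s3) ((isGT_pat _ _ _).addable_bumpRow hwl)
      have e7 : i + 1 + (l + 1) = i + 1 + l + 1 := by omega
      rw [e7, s3, hq, pat, rins_of_lt hwl]

theorem dual_zero (hL : GrowthDiagram R C N L) {i a : ℕ} (hi : i ≤ N) (ha : a < R) :
    L i N a + L 0 i (R - 1 - a) = C := by
  have hstep : ∀ l, ∃ q, l < N → L 0 (l + 1) = inc (L 0 l) q := by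
    intro l
    by_cases h : l < N
    · obtain ⟨q, hq⟩ := hL.step 0 l (by omega) (by omega)
      exact ⟨q, fun _ => hq⟩
    · exact ⟨0, fun h' => absurd h' h⟩
  choose w hw using hstep
  have h1 := hL.eq_pat hw (i := i) (l := N - i) (by omega)
  rw [Nat.add_sub_cancel' hi] at h1
  have h2 := hL.full 0
  rw [zero_add] at h2
  rw [h1, pat_end_eq (f := L 0) hw (fun l _ => hL.anti 0 l) h2
    (fun l hl => hL.le (by omega) (by omega)) (by omega) le_rfl, if_pos ha]
  have := hL.le (i := 0) (j := i) (by omega) (by omega) (R - 1 - a)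
  omega

/-- Shapes at dual positions of a growth diagram are complementary in the rectangle. -/
theorem dual (hL : GrowthDiagram R C N L) {i j a : ℕ} (hij : i ≤ j) (hj : j ≤ i + N)
    (ha : a < R) : L j (i + N) a + L i j (R - 1 - a) = C := by
  have := (hL.translate i).dual_zero (i := j - i) (by omega) ha
  rwa [Nat.add_sub_cancel' hij] at this

end GrowthDiagram

namespace GrowthDiagram

variable {R C N : ℕ} {L : ℕ → ℕ → ℕ → ℕ}

theorem exists_hole_of_hole (hL : GrowthDiagram R C N L) {i j k p : ℕ} (hij : i < j)
    (hjk : j ≤ k) (hk : k ≤ i + N) (hp : L i j = inc (L (i + 1) j) p) :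
    ∃ q, p ≤ q ∧ L i k = inc (L (i + 1) k) q := by
  induction k, hjk using Nat.le_induction with
  | base => exact ⟨p, le_rfl, hp⟩
  | succ k hjk ih =>
    obtain ⟨q, hpq, hq⟩ := ih (by omega)
    obtain ⟨p₀, q₀, p₁, q₁, h1, h2, h3, h4⟩ := hL.square i k (by omega) (by omega)
    rw [h1] at hq
    obtain rfl := inc_left_injective hq
    refine ⟨p₁, ?_, ?_⟩
    · unfold LocalRule at h4
      omega
    · rw [h2, h1, h3]
      exact h4.inc_inc

theorem exists_hole (hL : GrowthDiagram R C N L) {i j : ℕ} (hij : i < j) (hj : j ≤ i + N) :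
    ∃ p, L i j = inc (L (i + 1) j) p := by
  obtain ⟨q, hq⟩ := hL.step i i le_rfl (by omega)
  rw [hL.diag, ← hL.diag (i + 1)] at hq
  obtain ⟨p, -, hp⟩ := hL.exists_hole_of_hole (Nat.lt_succ_self i) hij hj hq
  exact ⟨p, hp⟩

theorem anti_left (hL : GrowthDiagram R C N L) {i k j : ℕ} (hik : i ≤ k) (hkj : k ≤ j)
    (hj : j ≤ i + N) (a : ℕ) : L k j a ≤ L i j a := by
  induction k, hik using Nat.le_induction with
  | base => exact le_rfl
  | succ k hik ih =>
    obtain ⟨p, hp⟩ := hL.exists_hole (i := k) (j := j) (by omega) (by omega)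
    refine le_trans ?_ (ih (by omega))
    rw [hp, inc_apply]
    split_ifs <;> omega

theorem periodic (hL : GrowthDiagram R C N L) {i j : ℕ} (hij : i ≤ j) (hj : j ≤ i + N) :
    L (i + N) (j + N) = L i j := by
  funext a
  rcases Nat.lt_or_ge a R with ha | ha
  · have h1 := hL.dual (a := a) hj (by omega : i + N ≤ j + N) ha
    have h2 := hL.dual (a := R - 1 - a) hij hj (by omega)
    have h3 : R - 1 - (R - 1 - a) = a := by omega
    rw [h3] at h2
    omega
  · rw [hL.zero _ _ _ ha, hL.zero _ _ _ ha]

end GrowthDiagram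

/-- The sliding path of the `i`-th slide drops into row `r` by moving the entry `j + 1`. -/
structure Drop (N r : ℕ) (L : ℕ → ℕ → ℕ → ℕ) (i j : ℕ) : Prop where
  lt : i < j
  lt_add : j < i + N
  before : L i j = inc (L (i + 1) j) (r - 1)
  after : L i (j + 1) = inc (L (i + 1) (j + 1)) r

namespace Drop

variable {R C N r : ℕ} {L : ℕ → ℕ → ℕ → ℕ} {i j k : ℕ}

theorem unique (hL : GrowthDiagram R C N L) (hr : 1 ≤ r) (hj : Drop N r L i j)
    (hk : Drop N r L i k) : j = k := by
  have key : ∀ {j k}, Drop N r L i j → Drop N r L i k → ¬j < k := by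
    intro j k hj hk hlt
    have h1 := hj.lt
    have h2 := hk.lt_add
    obtain ⟨q, hq1, hq2⟩ := hL.exists_hole_of_hole (by omega) hlt (by omega) hj.after
    rw [hk.before] at hq2
    have := inc_left_injective hq2
    omega
  have := key hj hk
  have := key hk hj
  omega

theorem growth (hL : GrowthDiagram R C N L) (hr : 1 ≤ r) (h : Drop N r L i j) :
    L i (j + 1) = inc (L i j) r ∧ L (i + 1) (j + 1) = inc (L (i + 1) j) (r - 1) := by
  obtain ⟨p, q, p', q', h1, h2, h3, h4⟩ := hL.square i j h.lt h.lt_add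
  have e1 := inc_left_injective (h1.symm.trans h.before)
  have h5 : L i (j + 1) = inc (L (i + 1) (j + 1)) p' := by
    rw [h2, h1, h3]
    exact h4.inc_inc
  have e2 := inc_left_injective (h5.symm.trans h.after)
  unfold LocalRule at h4
  have e3 : q' = r := by omega
  have e4 : q = r - 1 := by omega
  exact ⟨e3 ▸ h2, e4 ▸ h3⟩

theorem dual (hL : GrowthDiagram (2 * r) C N L) (hr : 1 ≤ r) (h : Drop N r L i j) :
    Drop N r L j (i + N) := by
  obtain ⟨h1, h2⟩ := h.growth hL hr
  have hij := h.lt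
  have hj := h.lt_add
  refine ⟨hj, by omega, ?_, ?_⟩
  · funext a
    rcases Nat.lt_or_ge a (2 * r) with ha | ha
    · have e1 := hL.dual hij.le hj.le ha
      have e2 := hL.dual (by omega : i ≤ j + 1) (by omega) ha
      rw [h1] at e2
      rw [inc_apply] at e2 ⊢
      split_ifs at * <;> omega
    · rw [inc_apply, if_neg (by omega), hL.zero _ _ _ ha, hL.zero _ _ _ ha]
  · funext a
    have e : i + N + 1 = i + 1 + N := by omega
    rw [e]
    rcases Nat.lt_or_ge a (2 * r) with ha | ha
    · have e1 := hL.dual (by omega : i + 1 ≤ j) (by omega) ha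
      have e2 := hL.dual (by omega : i + 1 ≤ j + 1) (by omega) ha
      rw [h2] at e2
      rw [inc_apply] at e2 ⊢
      split_ifs at * <;> omega
    · rw [inc_apply, if_neg (by omega), hL.zero _ _ _ ha, hL.zero _ _ _ ha]

theorem of_add (hL : GrowthDiagram R C N L) (h : Drop N r L (i + N) (j + N)) :
    Drop N r L i j := by
  obtain ⟨h1, h2, h3, h4⟩ := h
  have e1 : i + N + 1 = i + 1 + N := by omega
  have e2 : j + N + 1 = j + 1 + N := by omega
  rw [e1, hL.periodic (by omega) (by omega), hL.periodic (by omega) (by omega)] at h3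
  rw [e1, e2, hL.periodic (by omega) (by omega), hL.periodic (by omega) (by omega)] at h4
  exact ⟨by omega, by omega, h3, h4⟩

end Drop

/-- Residues modulo `N` of the drops define a fixed-point-free involution. -/
theorem GrowthDiagram.involution_of_drop {C N r : ℕ} {L : ℕ → ℕ → ℕ → ℕ}
    (hL : GrowthDiagram (2 * r) C N L) (hr : 1 ≤ r) {f : ℕ → ℕ}
    (hf : ∀ i, ∃ j, Drop N r L i j ∧ f (i + 1) = j % N + 1) {a : ℕ} (ha : a ∈ Set.Icc 1 N) :
    f a ∈ Set.Icc 1 N ∧ f (f a) = a ∧ f a ≠ a := by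
  obtain ⟨ha1, ha2⟩ := ha
  obtain ⟨i, rfl⟩ : ∃ i, a = i + 1 := ⟨a - 1, by omega⟩
  obtain ⟨j, hj, e⟩ := hf i
  have h1 := hj.lt
  have h2 := hj.lt_add
  have hd := hj.dual hL hr
  have hm := Nat.mod_lt j (by omega : 0 < N)
  obtain ⟨k, hk, e'⟩ := hf (j % N)
  rw [e, e', Set.mem_Icc]
  rcases Nat.lt_or_ge j N with h | h
  · rw [Nat.mod_eq_of_lt h] at *
    obtain rfl := hk.unique hL hr hd
    rw [Nat.add_mod_right, Nat.mod_eq_of_lt (by omega : i < N)]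
    omega
  · rw [Nat.mod_eq_sub_mod h, Nat.mod_eq_of_lt (by omega : j - N < N)] at *
    rw [← Nat.sub_add_cancel h] at hd
    obtain rfl := hk.unique hL hr (hd.of_add hL)
    rw [Nat.mod_eq_of_lt (by omega)]
    omega

/-- If the first half of the first row fills the upper half of the rectangle, then the drops
into row `r` of the first half of the slides occur in the second half. -/
theorem GrowthDiagram.drop_mem {C n r : ℕ} {L : ℕ → ℕ → ℕ → ℕ}
    (hL : GrowthDiagram (2 * r) C (2 * n) L) (hr : 1 ≤ r)
    (hn : ∀ a, L 0 n a = if a < r then C else 0) {i j : ℕ} (hi : i < n)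
    (hj : Drop (2 * n) r L i j) : n ≤ j ∧ j < 2 * n := by
  have h1 := hj.lt
  have h2 := hj.lt_add
  constructor
  · by_contra hc
    have e1 := congrFun (hj.growth hL hr).1 r
    rw [inc_apply, if_pos rfl] at e1
    have e2 := hL.mono (i := i) (j := j + 1) (k := n) (by omega) (by omega) (by omega) r
    have e3 := hL.anti_left (i := 0) (k := i) (j := n) (by omega) (by omega) (by omega) r
    rw [hn, if_neg (by omega)] at e3
    omega
  · by_contra hc
    obtain ⟨p, hp⟩ := hL.exists_hole (i := i) (j := 2 * n) (by omega) (by omega)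
    obtain ⟨q, hq1, hq2⟩ := hL.exists_hole_of_hole (by omega) (by omega : 2 * n ≤ j)
      (by omega) hp
    rw [hj.before] at hq2
    have hq := inc_left_injective hq2
    have e1 := hL.le (i := i) (j := 2 * n) (by omega) (by omega) p
    rw [hp, inc_apply, if_pos rfl] at e1
    have e2 := hL.anti_left (i := i + 1) (k := n) (j := 2 * n) (by omega) (by omega)
      (by omega) p
    have e3 := hL.dual (i := 0) (j := n) (a := p) (by omega) (by omega) (by omega)
    rw [hn, if_neg (by omega), zero_add] at e3
    omega

/-! ## Sliding paths and gromotion -/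

/-- A rectangular standard tableau with entries `s + 1, …, s + R * C`. -/
structure IsShiftedSYT (R C s : ℕ) (T : ℕ → ℕ → ℕ) : Prop where
  row : ∀ i j, i < R → j + 1 < C → T i j < T i (j + 1)
  col : ∀ i j, i + 1 < R → j < C → T i j < T (i + 1) j
  bij : Set.BijOn (fun p : ℕ × ℕ => T p.1 p.2) {p : ℕ × ℕ | p.1 < R ∧ p.2 < C}
    (Set.Icc (s + 1) (s + R * C))

namespace IsShiftedSYT

variable {R C s : ℕ} {T : ℕ → ℕ → ℕ}

theorem mem (hT : IsShiftedSYT R C s T) {i j : ℕ} (hi : i < R) (hj : j < C) :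
    s + 1 ≤ T i j ∧ T i j ≤ s + R * C :=
  hT.bij.mapsTo (show (i, j) ∈ {p : ℕ × ℕ | p.1 < R ∧ p.2 < C} from ⟨hi, hj⟩)

theorem inj (hT : IsShiftedSYT R C s T) {i j i' j' : ℕ} (hi : i < R) (hj : j < C)
    (hi' : i' < R) (hj' : j' < C) (h : T i j = T i' j') : i = i' ∧ j = j' :=
  Prod.mk.inj (hT.bij.injOn (show (i, j) ∈ {p : ℕ × ℕ | p.1 < R ∧ p.2 < C} from ⟨hi, hj⟩)
    (show (i', j') ∈ {p : ℕ × ℕ | p.1 < R ∧ p.2 < C} from ⟨hi', hj'⟩) h)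

theorem surj (hT : IsShiftedSYT R C s T) {v : ℕ} (h1 : s + 1 ≤ v) (h2 : v ≤ s + R * C) :
    ∃ i j, i < R ∧ j < C ∧ T i j = v := by
  obtain ⟨⟨i, j⟩, ⟨hi, hj⟩, h⟩ := hT.bij.surjOn (Set.mem_Icc.2 ⟨h1, h2⟩)
  exact ⟨i, j, hi, hj, h⟩

theorem row_lt (hT : IsShiftedSYT R C s T) {i j k : ℕ} (hi : i < R) (hjk : j < k) (hk : k < C) :
    T i j < T i k := by
  induction k, hjk using Nat.le_induction with
  | base => exact hT.row i j hi hk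
  | succ k hjk ih => exact (ih (by omega)).trans (hT.row i k hi hk)

theorem col_lt (hT : IsShiftedSYT R C s T) {i j k : ℕ} (hj : j < C) (hik : i < k) (hk : k < R) :
    T i j < T k j := by
  induction k, hik using Nat.le_induction with
  | base => exact hT.col i j hk hj
  | succ k hik ih => exact (ih (by omega)).trans (hT.col k j hk hj)

theorem corner (hT : IsShiftedSYT R C s T) (hR : 0 < R) (hC : 0 < C) : T 0 0 = s + 1 := by
  have h0 := Nat.mul_pos hR hC
  obtain ⟨i, j, hi, hj, h⟩ := hT.surj le_rfl (by omega)
  have h1 := (hT.mem hR hC).1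
  rcases Nat.eq_zero_or_pos i with rfl | h2
  · rcases Nat.eq_zero_or_pos j with rfl | h3
    · exact h
    · have := hT.row_lt hR h3 hj
      omega
  · have h4 := hT.col_lt hj h2 hi
    have h5 := (hT.mem hR hj).1
    omega

theorem maxEntry_eq (hT : IsShiftedSYT R C s T) (hR : 0 < R) (hC : 0 < C) :
    maxEntry R C T = s + R * C := by
  have h0 := Nat.mul_pos hR hC
  refine le_antisymm (Finset.sup_le fun p hp => ?_) ?_
  · rw [Finset.mem_product, Finset.mem_range, Finset.mem_range] at hp
    exact (hT.mem hp.1 hp.2).2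
  · obtain ⟨i, j, hi, hj, h⟩ := hT.surj (by omega) le_rfl
    rw [← h]
    exact Finset.le_sup (f := fun p : ℕ × ℕ => T p.1 p.2) (b := (i, j))
      (Finset.mem_product.2 ⟨Finset.mem_range.2 hi, Finset.mem_range.2 hj⟩)

end IsShiftedSYT

section Path

variable {R C s : ℕ} {T : ℕ → ℕ → ℕ}

/-- One step of the sliding path, away from the bottom right corner. -/
theorem nextCell_cases (T : ℕ → ℕ → ℕ) {x y : ℕ} (hx : x < R) (hy : y < C)
    (h : x + y < R + C - 2) :
    (nextCell R C T (x, y) = (x, y + 1) ∧ y + 1 < C ∧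
      (x + 1 < R → T x (y + 1) < T (x + 1) y)) ∨
    (nextCell R C T (x, y) = (x + 1, y) ∧ x + 1 < R ∧
      (y + 1 < C → T (x + 1) y ≤ T x (y + 1))) := by
  unfold nextCell PromRS.ext
  simp only [hx, hy, true_and, and_true]
  by_cases h1 : y + 1 < C <;> by_cases h2 : x + 1 < R
  · simp only [h1, h2, if_true, Nat.cast_lt, true_and, forall_true_left]
    split_ifs with h3
    · exact Or.inl ⟨rfl, h3⟩
    · exact Or.inr ⟨rfl, by omega⟩
  · left
    simp [h1, h2]
  · right
    simp [h1, h2]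
  · omega

theorem slidePath_spec (T : ℕ → ℕ → ℕ) (hR : 0 < R) (hC : 0 < C) {k : ℕ}
    (hk : k ≤ R + C - 2) :
    (slidePath R C T k).1 < R ∧ (slidePath R C T k).2 < C ∧
      (slidePath R C T k).1 + (slidePath R C T k).2 = k := by
  induction k with
  | zero => exact ⟨hR, hC, rfl⟩
  | succ k ih =>
    obtain ⟨h1, h2, h3⟩ := ih (by omega)
    rw [slidePath]
    rcases nextCell_cases T h1 h2 (by omega) with ⟨h, h4, -⟩ | ⟨h, h4, -⟩ <;> rw [h] <;>
      exact ⟨by omega, by omega, by omega⟩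

/-- The entry of `T` at the `k`-th cell of the sliding path. -/
def pathEntry (R C : ℕ) (T : ℕ → ℕ → ℕ) (k : ℕ) : ℕ :=
  T (slidePath R C T k).1 (slidePath R C T k).2

/-- One step of the sliding path, with the comparison of the two candidate entries. -/
theorem slidePath_succ_cases (T : ℕ → ℕ → ℕ) (hR : 0 < R) (hC : 0 < C) {k x y : ℕ}
    (hk : k + 1 ≤ R + C - 2) (hp : slidePath R C T k = (x, y)) :
    (slidePath R C T (k + 1) = (x, y + 1) ∧ y + 1 < C ∧
      (x + 1 < R → T x (y + 1) < T (x + 1) y)) ∨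
    (slidePath R C T (k + 1) = (x + 1, y) ∧ x + 1 < R ∧
      (y + 1 < C → T (x + 1) y ≤ T x (y + 1))) := by
  obtain ⟨h1, h2, h3⟩ := slidePath_spec T hR hC (by omega : k ≤ R + C - 2)
  rw [slidePath, hp]
  rw [hp] at h1 h2 h3
  exact nextCell_cases T h1 h2 (by simp only at h3; omega)

namespace IsShiftedSYT

theorem pathEntry_lt_succ (hT : IsShiftedSYT R C s T) (hR : 0 < R) (hC : 0 < C) {k : ℕ}
    (hk : k + 1 ≤ R + C - 2) : pathEntry R C T k < pathEntry R C T (k + 1) := by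
  obtain ⟨h1, h2, h3⟩ := slidePath_spec T hR hC (by omega : k ≤ R + C - 2)
  unfold pathEntry
  rcases slidePath_succ_cases T hR hC hk rfl with ⟨h, h4, -⟩ | ⟨h, h4, -⟩ <;> rw [h]
  · exact hT.row _ _ h1 h4
  · exact hT.col _ _ h4 h2

theorem pathEntry_lt (hT : IsShiftedSYT R C s T) (hR : 0 < R) (hC : 0 < C) {k l : ℕ}
    (hkl : k < l) (hl : l ≤ R + C - 2) : pathEntry R C T k < pathEntry R C T l := by
  induction l, hkl using Nat.le_induction with
  | base => exact hT.pathEntry_lt_succ hR hC hl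
  | succ l hkl ih => exact (ih (by omega)).trans (hT.pathEntry_lt_succ hR hC hl)

theorem gromotion_corner (hT : IsShiftedSYT R C s T) (hR : 0 < R) (hC : 0 < C) {i j : ℕ}
    (hi : i < R) (hj : j < C) (h : R + C - 2 ≤ i + j) :
    gromotion R C T i j = s + R * C + 1 := by
  unfold gromotion
  rw [if_pos (by omega), hT.maxEntry_eq hR hC]

end IsShiftedSYT

theorem gromotion_of_mem (T : ℕ → ℕ → ℕ) (hR : 0 < R) (hC : 0 < C) {i j k : ℕ}
    (hk : k + 1 ≤ R + C - 2) (h : slidePath R C T k = (i, j)) :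
    gromotion R C T i j = pathEntry R C T (k + 1) := by
  have hs := slidePath_spec T hR hC (by omega : k ≤ R + C - 2)
  rw [h] at hs
  simp only at hs
  have hf : (List.range (R + C - 2)).find? (fun k => decide (slidePath R C T k = (i, j))) =
      some k := by
    rw [List.find?_range_eq_some]
    refine ⟨by simp [h], by simp; omega, fun l hl => ?_⟩
    have hs' := slidePath_spec T hR hC (by omega : l ≤ R + C - 2)
    simp only [Bool.not_eq_eq_eq_not, Bool.not_true, decide_eq_false_iff_not]
    intro hc
    rw [hc] at hs'
    omega
  unfold gromotion
  rw [if_neg (by omega), hf]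
  rfl

theorem gromotion_of_notMem (T : ℕ → ℕ → ℕ) (hR : 0 < R) (hC : 0 < C) {i j : ℕ}
    (hi : i < R) (hj : j < C) (h : slidePath R C T (i + j) ≠ (i, j)) :
    gromotion R C T i j = T i j := by
  have hf : (List.range (R + C - 2)).find? (fun k => decide (slidePath R C T k = (i, j))) =
      none := by
    rw [List.find?_eq_none]
    intro k hk hc
    rw [List.mem_range] at hk
    have hs := slidePath_spec T hR hC (by omega : k ≤ R + C - 2)
    rw [of_decide_eq_true hc] at hs
    simp only at hs
    rw [hs.2.2] at h
    exact h (of_decide_eq_true hc)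
  have hne : ¬(i = R - 1 ∧ j = C - 1) := by
    rintro ⟨rfl, rfl⟩
    have hs := slidePath_spec T hR hC (by omega : R - 1 + (C - 1) ≤ R + C - 2)
    exact h (Prod.ext (by simp only; omega) (by simp only; omega))
  unfold gromotion
  rw [if_neg hne, hf]

/-- Every cell is off the sliding path, on it before the corner, or the corner. -/
theorem slidePath_trichotomy (T : ℕ → ℕ → ℕ) {i j : ℕ} (hi : i < R) (hj : j < C) :
    slidePath R C T (i + j) ≠ (i, j) ∨
    (slidePath R C T (i + j) = (i, j) ∧ i + j + 1 ≤ R + C - 2) ∨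
    (slidePath R C T (i + j) = (i, j) ∧ i + j = R + C - 2) := by
  by_cases h : slidePath R C T (i + j) = (i, j)
  · right
    rcases Nat.lt_or_ge (i + j) (R + C - 2) with h' | h'
    · exact Or.inl ⟨h, h'⟩
    · exact Or.inr ⟨h, by omega⟩
  · exact Or.inl h

theorem pathEntry_of_eq {T : ℕ → ℕ → ℕ} {i j k : ℕ} (h : slidePath R C T k = (i, j)) :
    pathEntry R C T k = T i j := by
  rw [pathEntry, h]

namespace IsShiftedSYT

theorem lt_gromotion (hT : IsShiftedSYT R C s T) (hR : 0 < R) (hC : 0 < C) {i j : ℕ}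
    (hi : i < R) (hj : j < C) (h : slidePath R C T (i + j) = (i, j)) :
    T i j < gromotion R C T i j := by
  rcases Nat.lt_or_ge (i + j) (R + C - 2) with h' | h'
  · rw [gromotion_of_mem T hR hC h' h, ← pathEntry_of_eq h]
    exact hT.pathEntry_lt_succ hR hC h'
  · rw [hT.gromotion_corner hR hC hi hj h']
    have := (hT.mem hi hj).2
    omega

theorem le_gromotion (hT : IsShiftedSYT R C s T) (hR : 0 < R) (hC : 0 < C) {i j : ℕ}
    (hi : i < R) (hj : j < C) : T i j ≤ gromotion R C T i j := by
  by_cases h : slidePath R C T (i + j) = (i, j)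
  · exact (hT.lt_gromotion hR hC hi hj h).le
  · exact (gromotion_of_notMem T hR hC hi hj h).ge

theorem gromotion (hT : IsShiftedSYT R C s T) (hR : 0 < R) (hC : 0 < C) :
    IsShiftedSYT R C (s + 1) (gromotion R C T) where
  row i j hi hj := by
    have hle := hT.le_gromotion hR hC hi hj
    have hlt := hT.row i j hi hj
    rcases slidePath_trichotomy T hi (by omega : j < C) with h | ⟨h, h'⟩ | ⟨h, h'⟩
    · rw [gromotion_of_notMem T hR hC hi (by omega) h]
      omega
    · rw [gromotion_of_mem T hR hC h' h]
      rcases slidePath_succ_cases T hR hC h' h with ⟨e, -, -⟩ | ⟨e, h1, h2⟩ <;>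
        rw [pathEntry_of_eq e]
      · exact hT.lt_gromotion hR hC hi hj e
      · have h3 := h2 hj
        have h4 : T (i + 1) j ≠ T i (j + 1) := fun hc => by
          have := hT.inj h1 (by omega) hi hj hc
          omega
        omega
    · omega
  col i j hi hj := by
    have hle := hT.le_gromotion hR hC hi hj
    have hlt := hT.col i j hi hj
    rcases slidePath_trichotomy T (by omega : i < R) hj with h | ⟨h, h'⟩ | ⟨h, h'⟩
    · rw [gromotion_of_notMem T hR hC (by omega) hj h]
      omega
    · rw [gromotion_of_mem T hR hC h' h]
      rcases slidePath_succ_cases T hR hC h' h with ⟨e, h1, h2⟩ | ⟨e, -, -⟩ <;>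
        rw [pathEntry_of_eq e]
      · have h3 := h2 hi
        omega
      · refine hT.lt_gromotion hR hC hi hj ?_
        rwa [Nat.add_right_comm]
    · omega
  bij := by
    have h0 := Nat.mul_pos hR hC
    have hmaps : Set.MapsTo (fun p : ℕ × ℕ => PromRS.gromotion R C T p.1 p.2)
        {p : ℕ × ℕ | p.1 < R ∧ p.2 < C} (Set.Icc (s + 1 + 1) (s + 1 + R * C)) := by
      rintro ⟨i, j⟩ ⟨hi, hj⟩
      simp only at hi hj
      have h1 := hT.mem hi hj
      rw [Set.mem_Icc]
      rcases slidePath_trichotomy T hi hj with h | ⟨h, h'⟩ | ⟨h, h'⟩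
      · simp only
        rw [gromotion_of_notMem T hR hC hi hj h]
        have h2 : T i j ≠ s + 1 := fun hc => by
          rw [← hT.corner hR hC] at hc
          obtain ⟨rfl, rfl⟩ := hT.inj hi hj hR hC hc
          exact h rfl
        omega
      · have h2 := hT.lt_gromotion hR hC hi hj h
        obtain ⟨h3, h4, -⟩ := slidePath_spec T hR hC h'
        have h5 := hT.mem h3 h4
        simp only
        rw [gromotion_of_mem T hR hC h' h] at h2 ⊢
        rw [pathEntry] at h2 ⊢
        omega
      · simp only
        rw [hT.gromotion_corner hR hC hi hj (by omega)]
        omega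
    have hsurj : Set.SurjOn (fun p : ℕ × ℕ => PromRS.gromotion R C T p.1 p.2)
        {p : ℕ × ℕ | p.1 < R ∧ p.2 < C} (Set.Icc (s + 1 + 1) (s + 1 + R * C)) := by
      rintro v ⟨h1, h2⟩
      rcases Nat.lt_or_ge (s + R * C) v with hv | hv
      · refine ⟨(R - 1, C - 1), ⟨by simp only; omega, by simp only; omega⟩, ?_⟩
        simp only
        rw [hT.gromotion_corner hR hC (by omega) (by omega) (by omega)]
        omega
      · obtain ⟨i, j, hi, hj, rfl⟩ := hT.surj (by omega) hv
        by_cases h : slidePath R C T (i + j) = (i, j)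
        · obtain ⟨k, hk⟩ : ∃ k, i + j = k + 1 := by
            refine ⟨i + j - 1, ?_⟩
            by_contra hc
            obtain ⟨rfl, rfl⟩ : i = 0 ∧ j = 0 := by omega
            rw [hT.corner hR hC] at h1
            omega
          obtain ⟨h3, h4, h5⟩ := slidePath_spec T hR hC (by omega : k ≤ R + C - 2)
          refine ⟨slidePath R C T k, ⟨h3, h4⟩, ?_⟩
          simp only
          rw [gromotion_of_mem T hR hC (by omega) rfl, ← pathEntry_of_eq h, hk]
        · exact ⟨(i, j), ⟨hi, hj⟩, gromotion_of_notMem T hR hC hi hj h⟩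
    refine ⟨hmaps, ?_, hsurj⟩
    have hset : {p : ℕ × ℕ | p.1 < R ∧ p.2 < C} =
        ((Finset.range R ×ˢ Finset.range C : Finset (ℕ × ℕ)) : Set (ℕ × ℕ)) := by
      ext p
      simp
    rw [hset] at hmaps hsurj ⊢
    rw [← Finset.coe_Icc] at hmaps hsurj
    refine Finset.injOn_of_surjOn_of_card_le _ hmaps hsurj ?_
    rw [Finset.card_product, Finset.card_range, Finset.card_range, Nat.card_Icc]
    omega

end IsShiftedSYT
end Path

/-- The shape of the entries of `T` that are at most `j`. -/
def shapeLE (R C : ℕ) (T : ℕ → ℕ → ℕ) (j a : ℕ) : ℕ :=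
  if a < R then ((Finset.range C).filter fun y => T a y ≤ j).card else 0

section Shape

variable {R C s j : ℕ} {T : ℕ → ℕ → ℕ}

theorem shapeLE_eq_inc {A B : ℕ → ℕ → ℕ} {j k x y : ℕ} (hx : x < R) (hy : y < C)
    (h : ∀ a b, a < R → b < C → (A a b ≤ j ↔ B a b ≤ k ∨ (a = x ∧ b = y))) (hB : k < B x y) :
    shapeLE R C A j = inc (shapeLE R C B k) x := by
  funext a
  rw [inc_apply]
  unfold shapeLE
  by_cases ha : a < R
  · rw [if_pos ha, if_pos ha]
    split_ifs with hax
    · subst hax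
      rw [← Finset.card_insert_of_notMem (a := y)
        (s := (Finset.range C).filter fun y => B a y ≤ k) (by simp; omega)]
      congr 1
      ext b
      simp only [Finset.mem_filter, Finset.mem_insert, Finset.mem_range]
      constructor
      · rintro ⟨hb, h1⟩
        have := (h a b ha hb).1 h1
        omega
      · rintro (rfl | ⟨hb, h1⟩)
        · exact ⟨hy, (h a b ha hy).2 (Or.inr ⟨rfl, rfl⟩)⟩
        · exact ⟨hb, (h a b ha hb).2 (Or.inl h1)⟩
    · congr 1
      ext b
      simp only [Finset.mem_filter, Finset.mem_range]
      constructor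
      · rintro ⟨hb, h1⟩
        have := (h a b ha hb).1 h1
        omega
      · rintro ⟨hb, h1⟩
        exact ⟨hb, (h a b ha hb).2 (Or.inl h1)⟩
  · rw [if_neg ha, if_neg ha, if_neg (by omega)]

/-- The `k`-th cell of the sliding path is the last one with an entry at most `j`. -/
def IsHole (R C : ℕ) (T : ℕ → ℕ → ℕ) (j k : ℕ) : Prop :=
  k ≤ R + C - 2 ∧ pathEntry R C T k ≤ j ∧ ∀ t, k < t → t ≤ R + C - 2 → j < pathEntry R C T t

namespace IsShiftedSYT

theorem shapeLE_of_eq (hT : IsShiftedSYT R C s T) {x y : ℕ} (hx : x < R) (hy : y < C)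
    (h : T x y = j + 1) : shapeLE R C T j x = y := by
  rw [shapeLE, if_pos hx]
  have : ((Finset.range C).filter fun b => T x b ≤ j) = Finset.range y := by
    ext b
    simp only [Finset.mem_filter, Finset.mem_range]
    constructor
    · rintro ⟨hb, h1⟩
      by_contra hc
      rcases Nat.eq_or_lt_of_le (not_lt.1 hc) with rfl | h2
      · omega
      · have := hT.row_lt hx h2 hb
        omega
    · intro hb
      have := hT.row_lt hx hb hy
      omega
  rw [this, Finset.card_range]

theorem shapeLE_zero (hT : IsShiftedSYT R C s T) : shapeLE R C T s = fun _ => 0 := by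
  funext a
  unfold shapeLE
  split_ifs with ha
  · rw [Finset.card_eq_zero, Finset.filter_eq_empty_iff]
    intro b hb
    have := (hT.mem ha (Finset.mem_range.1 hb)).1
    omega
  · rfl

theorem shapeLE_full (hT : IsShiftedSYT R C s T) {a : ℕ} (ha : a < R) :
    shapeLE R C T (s + R * C) a = C := by
  rw [shapeLE, if_pos ha, Finset.filter_true_of_mem, Finset.card_range]
  intro b hb
  exact (hT.mem ha (Finset.mem_range.1 hb)).2

theorem shapeLE_anti (hT : IsShiftedSYT R C s T) (j a : ℕ) :
    shapeLE R C T j (a + 1) ≤ shapeLE R C T j a := by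
  unfold shapeLE
  split_ifs with h1 h2
  · refine Finset.card_le_card fun b hb => ?_
    simp only [Finset.mem_filter, Finset.mem_range] at hb ⊢
    have := hT.col a b h1 hb.1
    omega
  · omega
  · exact Nat.zero_le _
  · exact le_rfl

theorem shapeLE_succ (hT : IsShiftedSYT R C s T) {x y : ℕ} (hx : x < R) (hy : y < C)
    (h : T x y = j + 1) : shapeLE R C T (j + 1) = inc (shapeLE R C T j) x := by
  refine shapeLE_eq_inc hx hy (fun a b ha hb => ⟨fun h1 => ?_, ?_⟩) (by omega)
  · rcases Nat.eq_or_lt_of_le h1 with h2 | h2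
    · exact Or.inr (hT.inj ha hb hx hy (h2.trans h.symm))
    · exact Or.inl (by omega)
  · rintro (h1 | ⟨rfl, rfl⟩) <;> omega

theorem exists_isHole (hT : IsShiftedSYT R C s T) (hR : 0 < R) (hC : 0 < C) (hj : s + 1 ≤ j) :
    ∃ k, IsHole R C T j k := by
  have h0 : pathEntry R C T 0 ≤ j := by
    change T 0 0 ≤ j
    rwa [hT.corner hR hC]
  refine ⟨Nat.findGreatest (fun k => pathEntry R C T k ≤ j) (R + C - 2),
    Nat.findGreatest_le _, ?_, fun t h1 h2 => ?_⟩
  · exact Nat.findGreatest_spec (P := fun k => pathEntry R C T k ≤ j) (Nat.zero_le _) h0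
  · exact not_le.1 (Nat.findGreatest_is_greatest (P := fun k => pathEntry R C T k ≤ j) h1 h2)

theorem isHole_succ_of_eq (hT : IsShiftedSYT R C s T) (hR : 0 < R) (hC : 0 < C) {k : ℕ}
    (hk : k + 1 ≤ R + C - 2) (h : pathEntry R C T (k + 1) = j + 1) :
    IsHole R C T j k ∧ IsHole R C T (j + 1) (k + 1) := by
  have h1 := hT.pathEntry_lt_succ hR hC hk
  refine ⟨⟨by omega, by omega, fun t h2 h3 => ?_⟩, hk, h.le, fun t h2 h3 => ?_⟩
  · rcases Nat.eq_or_lt_of_le h2 with rfl | h4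
    · change j < pathEntry R C T (k + 1)
      omega
    · have := hT.pathEntry_lt hR hC h4 h3
      simp only [Nat.succ_eq_add_one] at this
      omega
  · have := hT.pathEntry_lt hR hC h2 h3
    omega

theorem shapeLE_eq_inc_of_isHole (hT : IsShiftedSYT R C s T) (hR : 0 < R) (hC : 0 < C)
    {k : ℕ} (hj : j ≤ s + R * C) (hk : IsHole R C T j k) :
    shapeLE R C T j = inc (shapeLE R C (PromRS.gromotion R C T) j) (slidePath R C T k).1 := by
  obtain ⟨hk1, hk2, hk3⟩ := hk
  obtain ⟨h1, h2, h3⟩ := slidePath_spec T hR hC hk1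
  have hgt : j < PromRS.gromotion R C T (slidePath R C T k).1 (slidePath R C T k).2 := by
    rcases Nat.lt_or_ge k (R + C - 2) with h | h
    · rw [gromotion_of_mem T hR hC h rfl]
      exact hk3 _ (Nat.lt_succ_self k) h
    · rw [hT.gromotion_corner hR hC h1 h2 (by omega)]
      omega
  refine shapeLE_eq_inc h1 h2 (fun a b ha hb => ⟨fun h => ?_, ?_⟩) hgt
  · by_cases hp : slidePath R C T (a + b) = (a, b)
    · rcases lt_trichotomy (a + b) k with h4 | h4 | h4
      · left
        rw [gromotion_of_mem T hR hC (by omega) hp]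
        rcases Nat.eq_or_lt_of_le h4 with h5 | h5
        · change a + b + 1 = k at h5
          rwa [h5]
        · exact (hT.pathEntry_lt hR hC h5 hk1).le.trans hk2
      · right
        rw [← h4, hp]
        exact ⟨rfl, rfl⟩
      · have := hk3 _ h4 (by omega)
        rw [pathEntry_of_eq hp] at this
        omega
    · left
      rwa [gromotion_of_notMem T hR hC ha hb hp]
  · rintro (h | ⟨rfl, rfl⟩)
    · exact (hT.le_gromotion hR hC ha hb).trans h
    · exact hk2

theorem square (hT : IsShiftedSYT R C s T) (hR : 0 < R) (hC : 0 < C) (hj : s + 1 ≤ j)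
    (hj' : j + 1 ≤ s + R * C) : ∃ p q p' q',
      shapeLE R C T j = inc (shapeLE R C (PromRS.gromotion R C T) j) p ∧
      shapeLE R C T (j + 1) = inc (shapeLE R C T j) q' ∧
      shapeLE R C (PromRS.gromotion R C T) (j + 1) =
        inc (shapeLE R C (PromRS.gromotion R C T) j) q ∧
      LocalRule (shapeLE R C (PromRS.gromotion R C T) j) p q p' q' := by
  have hG := hT.gromotion hR hC
  obtain ⟨k, hk⟩ := hT.exists_isHole hR hC hj
  have e1 := hT.shapeLE_eq_inc_of_isHole hR hC (by omega) hk
  obtain ⟨x', y', hx', hy', e⟩ := hT.surj (by omega) hj'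
  have e2 := hT.shapeLE_succ hx' hy' e
  obtain ⟨hk1, hk2, hk3⟩ := hk
  obtain ⟨hx, hy, hxy⟩ := slidePath_spec T hR hC hk1
  generalize hp : slidePath R C T k = p at *
  obtain ⟨x, y⟩ := p
  simp only at hx hy hxy e1
  by_cases hc : k + 1 ≤ R + C - 2 ∧ slidePath R C T (k + 1) = (x', y')
  · obtain ⟨hk', hc⟩ := hc
    have g : PromRS.gromotion R C T x y = j + 1 := by
      rw [gromotion_of_mem T hR hC hk' hp, pathEntry_of_eq hc, e]
    refine ⟨x, x, x', x', e1, e2, hG.shapeLE_succ hx hy g, Or.inr ⟨rfl, rfl, ?_⟩⟩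
    rcases slidePath_succ_cases T hR hC hk' hp with ⟨h, -⟩ | ⟨h, -⟩ <;> rw [hc] at h <;>
      obtain ⟨rfl, rfl⟩ := Prod.mk.inj h
    · exact Or.inl rfl
    · right
      refine ⟨rfl, ?_⟩
      rw [hG.shapeLE_of_eq hx hy g]
      have := congrFun e1 (x + 1)
      rw [hT.shapeLE_of_eq hx' hy e, inc_apply, if_neg (by omega)] at this
      exact this.symm
  · have hoff : slidePath R C T (x' + y') ≠ (x', y') := by
      intro h
      have h1 := pathEntry_of_eq h
      rw [e] at h1
      rcases lt_trichotomy (x' + y') k with h2 | h2 | h2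
      · have := hT.pathEntry_lt hR hC h2 hk1
        omega
      · rw [h2] at h1
        omega
      · rcases Nat.eq_or_lt_of_le h2 with h3 | h3
        · change k + 1 = x' + y' at h3
          exact hc ⟨by omega, by rw [h3, h]⟩
        · change k + 1 < x' + y' at h3
          have := hT.pathEntry_lt hR hC h3 (by omega)
          have := hk3 (k + 1) (by omega) (by omega)
          omega
    have g : PromRS.gromotion R C T x' y' = j + 1 := by
      rw [gromotion_of_notMem T hR hC hx' hy' hoff, e]
    refine ⟨x, x', x, x', e1, e2, hG.shapeLE_succ hx' hy' g, Or.inl ⟨?_, rfl, rfl⟩⟩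
    rintro rfl
    rw [pathEntry_of_eq hp] at hk2
    have hlt : y < y' := by
      by_contra h
      rcases Nat.eq_or_lt_of_le (not_lt.1 h) with rfl | h
      · omega
      · have := hT.row_lt hx h hy
        omega
    have hk' : k + 1 ≤ R + C - 2 := by omega
    have h1 := hk3 (k + 1) (by omega) hk'
    have h2 : T x (y + 1) ≤ j + 1 := by
      rcases Nat.eq_or_lt_of_le hlt with h | h
      · change y + 1 = y' at h
        rw [h, e]
      · have := hT.row_lt hx h hy'
        change T x (y + 1) < _ at this
        omega
    rcases slidePath_succ_cases T hR hC hk' hp with ⟨h, h3, -⟩ | ⟨h, h3, h4⟩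
    · rw [pathEntry_of_eq h] at h1
      obtain ⟨-, rfl⟩ := hT.inj hx h3 hx hy' (by omega)
      exact hc ⟨hk', h⟩
    · rw [pathEntry_of_eq h] at h1
      have h5 := h4 (by omega)
      have h6 := hT.inj h3 hy hx hy' (by omega)
      omega

/-- The slide enters row `r` by moving the entry `slideInto R C T r` up from row `r` to
row `r - 1`. -/
theorem exists_slideInto (hT : IsShiftedSYT R C s T) (hR : 0 < R) (hC : 0 < C) {r : ℕ}
    (hr : 1 ≤ r) (hrR : r < R) : ∃ j, slideInto R C T r = j + 1 ∧ s < j ∧ j < s + R * C ∧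
      shapeLE R C T j = inc (shapeLE R C (PromRS.gromotion R C T) j) (r - 1) ∧
      shapeLE R C T (j + 1) = inc (shapeLE R C (PromRS.gromotion R C T) (j + 1)) r := by
  have hex : ∃ k, r ≤ (slidePath R C T k).1 := by
    obtain ⟨h1, h2, h3⟩ := slidePath_spec T hR hC le_rfl
    exact ⟨R + C - 2, by omega⟩
  obtain ⟨k, hk, hmin⟩ : ∃ k, r ≤ (slidePath R C T k).1 ∧
      ∀ l < k, (slidePath R C T l).1 < r :=
    ⟨Nat.find hex, Nat.find_spec hex, fun l hl => not_le.1 (Nat.find_min hex hl)⟩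
  have hkle : k ≤ R + C - 2 := by
    by_contra hc
    have := hmin (R + C - 2) (by omega)
    obtain ⟨h1, h2, h3⟩ := slidePath_spec T hR hC le_rfl
    omega
  cases k with
  | zero =>
    change r ≤ 0 at hk
    omega
  | succ k =>
    have h1 := hmin k (Nat.lt_succ_self k)
    have h2 : (slidePath R C T (k + 1)).1 = r ∧ (slidePath R C T k).1 = r - 1 := by
      rcases slidePath_succ_cases T hR hC hkle rfl with ⟨h, -⟩ | ⟨h, -⟩ <;> rw [h] at hk ⊢ <;>
        simp only at hk ⊢ <;> omega
    have hs : slideInto R C T r = pathEntry R C T (k + 1) := by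
      have hf : (List.range (R + C - 1)).find? (fun k => decide ((slidePath R C T k).1 = r)) =
          some (k + 1) := by
        rw [List.find?_range_eq_some]
        refine ⟨by simp [h2.1], by simp; omega, fun l hl => ?_⟩
        have := hmin l hl
        simp
        omega
      rw [slideInto, hf]
      rfl
    obtain ⟨h3, h4, -⟩ := slidePath_spec T hR hC (by omega : k ≤ R + C - 2)
    obtain ⟨h5, h6, -⟩ := slidePath_spec T hR hC hkle
    have h7 := hT.mem h3 h4
    have h8 := hT.mem h5 h6
    have h9 := hT.pathEntry_lt_succ hR hC hkle
    have h10 : pathEntry R C T (k + 1) = pathEntry R C T (k + 1) - 1 + 1 := by omega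
    obtain ⟨e1, e2⟩ := hT.isHole_succ_of_eq hR hC hkle h10
    change s + 1 ≤ pathEntry R C T k ∧ pathEntry R C T k ≤ _ at h7
    change s + 1 ≤ pathEntry R C T (k + 1) ∧ pathEntry R C T (k + 1) ≤ _ at h8
    refine ⟨pathEntry R C T (k + 1) - 1, hs.trans h10, by omega, by omega, ?_, ?_⟩
    · rw [← h2.2]
      exact hT.shapeLE_eq_inc_of_isHole hR hC (by omega) e1
    · rw [← h2.1]
      exact hT.shapeLE_eq_inc_of_isHole hR hC (by omega) e2

theorem iterate (hT : IsShiftedSYT R C s T) (hR : 0 < R) (hC : 0 < C) (i : ℕ) :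
    IsShiftedSYT R C (s + i) ((PromRS.gromotion R C)^[i] T) := by
  induction i with
  | zero => exact hT
  | succ i ih =>
    rw [Function.iterate_succ_apply']
    exact ih.gromotion hR hC

theorem growthDiagram (hT : IsShiftedSYT R C 0 T) (hR : 0 < R) (hC : 0 < C) :
    GrowthDiagram R C (R * C) fun i => shapeLE R C ((PromRS.gromotion R C)^[i] T) := by
  have hi : ∀ i, IsShiftedSYT R C i ((PromRS.gromotion R C)^[i] T) := fun i => by
    simpa using hT.iterate hR hC i
  refine ⟨fun i => (hi i).shapeLE_zero, fun i j a h => if_neg (by omega),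
    fun i => (hi i).shapeLE_anti, fun i a => (hi i).shapeLE_full, fun i j h1 h2 => ?_,
    fun i j h1 h2 => ?_⟩
  · obtain ⟨x, y, hx, hy, h⟩ := (hi i).surj (v := j + 1) (by omega) (by omega)
    exact ⟨x, (hi i).shapeLE_succ hx hy h⟩
  · simp only [Function.iterate_succ_apply']
    exact (hi i).square hR hC h1 h2

theorem exists_drop (hT : IsShiftedSYT R C 0 T) (hR : 0 < R) (hC : 0 < C) {r : ℕ}
    (hr : 1 ≤ r) (hrR : r < R) (i : ℕ) :
    ∃ j, Drop (R * C) r (fun i => shapeLE R C ((PromRS.gromotion R C)^[i] T)) i j ∧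
      promPerm R C T r (i + 1) = j % (R * C) + 1 := by
  have hi : IsShiftedSYT R C i ((PromRS.gromotion R C)^[i] T) := by
    simpa using hT.iterate hR hC i
  obtain ⟨j, h1, h2, h3, h4, h5⟩ := hi.exists_slideInto hR hC hr hrR
  refine ⟨j, ⟨h2, h3, ?_, ?_⟩, ?_⟩
  · simp only [Function.iterate_succ_apply']
    exact h4
  · simp only [Function.iterate_succ_apply']
    exact h5
  · rw [promPerm, Nat.add_sub_cancel, h1, Nat.add_sub_cancel]

end IsShiftedSYT

end Shape

section Stack

variable {r c : ℕ} {P Q : ℕ → ℕ → ℕ}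

theorem isShiftedSYT_stack (hP : IsSYT r c P) (hQ : IsSYT r c Q) :
    IsShiftedSYT (2 * r) c 0 (stack r c P Q) := by
  obtain ⟨p1, p2, p3⟩ := hP
  obtain ⟨q1, q2, q3⟩ := hQ
  have hPm : ∀ {i j}, i < r → j < c → 1 ≤ P i j ∧ P i j ≤ r * c := fun {i j} hi hj =>
    p3.mapsTo (show (i, j) ∈ {p : ℕ × ℕ | p.1 < r ∧ p.2 < c} from ⟨hi, hj⟩)
  have hQm : ∀ {i j}, i < r → j < c → 1 ≤ Q i j ∧ Q i j ≤ r * c := fun {i j} hi hj =>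
    q3.mapsTo (show (i, j) ∈ {p : ℕ × ℕ | p.1 < r ∧ p.2 < c} from ⟨hi, hj⟩)
  have e : 0 + 2 * r * c = r * c + r * c := by ring
  refine ⟨fun i j hi hj => ?_, fun i j hi hj => ?_, ?_, ?_, ?_⟩
  · unfold stack
    split_ifs with h
    · exact p1 i j h hj
    · have := q1 (i - r) j (by omega) hj
      omega
  · unfold stack
    split_ifs with h1 h2
    · exact p2 i j h2 hj
    · have := hPm h1 hj
      have := hQm (i := i + 1 - r) (by omega) hj
      omega
    · omega
    · have := q2 (i - r) j (by omega) hj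
      rw [show i + 1 - r = i - r + 1 by omega]
      omega
  · rintro ⟨i, j⟩ ⟨hi, hj⟩
    simp only at hi hj
    rw [e, Set.mem_Icc]
    simp only [stack]
    split_ifs with h
    · have := hPm h hj
      omega
    · have := hQm (i := i - r) (by omega) hj
      omega
  · rintro ⟨i, j⟩ ⟨hi, hj⟩ ⟨i', j'⟩ ⟨hi', hj'⟩ he
    simp only [stack] at hi hj hi' hj' he
    split_ifs at he with h1 h2 h2
    · exact p3.injOn (show (i, j) ∈ {p : ℕ × ℕ | p.1 < r ∧ p.2 < c} from ⟨h1, hj⟩)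
        (show (i', j') ∈ {p : ℕ × ℕ | p.1 < r ∧ p.2 < c} from ⟨h2, hj'⟩) he
    · have := hPm h1 hj
      have := hQm (i := i' - r) (by omega) hj'
      omega
    · have := hPm h2 hj'
      have := hQm (i := i - r) (by omega) hj
      omega
    · have h3 := q3.injOn
        (show (i - r, j) ∈ {p : ℕ × ℕ | p.1 < r ∧ p.2 < c} from ⟨by simp only; omega, hj⟩)
        (show (i' - r, j') ∈ {p : ℕ × ℕ | p.1 < r ∧ p.2 < c} from ⟨by simp only; omega, hj'⟩)
        (Nat.add_right_cancel he)
      rw [Prod.mk.injEq] at h3 ⊢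
      omega
  · rintro v ⟨h1, h2⟩
    rw [e] at h2
    rcases Nat.lt_or_ge (r * c) v with h | h
    · obtain ⟨⟨i, j⟩, ⟨hi, hj⟩, he⟩ := q3.surjOn (a := v - r * c)
        (Set.mem_Icc.2 ⟨by omega, by omega⟩)
      simp only at hi hj he
      refine ⟨(i + r, j), ⟨by simp only; omega, hj⟩, ?_⟩
      simp only [stack]
      rw [if_neg (by omega), Nat.add_sub_cancel, he]
      omega
    · obtain ⟨⟨i, j⟩, ⟨hi, hj⟩, he⟩ := p3.surjOn (a := v) (Set.mem_Icc.2 ⟨by omega, h⟩)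
      simp only at hi hj he
      refine ⟨(i, j), ⟨by simp only; omega, hj⟩, ?_⟩
      simp only [stack]
      rw [if_pos hi, he]

theorem shapeLE_stack (hP : IsSYT r c P) (hQ : IsSYT r c Q) (a : ℕ) :
    shapeLE (2 * r) c (stack r c P Q) (r * c) a = if a < r then c else 0 := by
  unfold shapeLE stack
  by_cases ha : a < r
  · rw [if_pos (by omega), if_pos ha, Finset.filter_true_of_mem, Finset.card_range]
    intro b hb
    rw [if_pos ha]
    exact (hP.2.2.mapsTo (show (a, b) ∈ {p : ℕ × ℕ | p.1 < r ∧ p.2 < c} from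
      ⟨ha, Finset.mem_range.1 hb⟩)).2
  · rw [if_neg ha]
    split_ifs with h
    · rw [Finset.card_eq_zero, Finset.filter_eq_empty_iff]
      intro b hb
      have h1 := (hQ.2.2.mapsTo (show (a - r, b) ∈ {p : ℕ × ℕ | p.1 < r ∧ p.2 < c} from
        ⟨by simp only; omega, Finset.mem_range.1 hb⟩)).1
      simp only at h1
      omega
    · rfl

end Stack

/-- For `r, c ≥ 1`, `n = rc`, and `P, Q ∈ SYT(r × c)` with
`S = stack(P, Q)`: `prom_r(S)` is a fixed-point-free involution of `{1, …, 2n}`, and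
every 2-cycle `(a b)` of `prom_r(S)` has `a ∈ {1, …, n}` and `b ∈ {n+1, …, 2n}`. -/
theorem promPerm_stack_involution (r c : ℕ) (hr : 1 ≤ r) (hc : 1 ≤ c)
    (P Q : ℕ → ℕ → ℕ) (hP : IsSYT r c P) (hQ : IsSYT r c Q) :
    Set.BijOn (promPerm (2 * r) c (stack r c P Q) r)
      (Set.Icc 1 (2 * (r * c))) (Set.Icc 1 (2 * (r * c))) ∧
    (∀ a ∈ Set.Icc 1 (2 * (r * c)),
      promPerm (2 * r) c (stack r c P Q) r (promPerm (2 * r) c (stack r c P Q) r a) = a ∧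
      promPerm (2 * r) c (stack r c P Q) r a ≠ a) ∧
    (∀ a ∈ Set.Icc 1 (r * c),
      r * c + 1 ≤ promPerm (2 * r) c (stack r c P Q) r a ∧
      promPerm (2 * r) c (stack r c P Q) r a ≤ 2 * (r * c)) := by
  have hS := isShiftedSYT_stack hP hQ
  have hL := hS.growthDiagram (by omega) hc
  have hf := hS.exists_drop (by omega) hc hr (by omega)
  rw [Nat.mul_assoc] at hL hf
  have key := fun a ha => hL.involution_of_drop (a := a) hr hf ha
  have hinv : Set.LeftInvOn (promPerm (2 * r) c (stack r c P Q) r)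
      (promPerm (2 * r) c (stack r c P Q) r) (Set.Icc 1 (2 * (r * c))) :=
    fun a ha => (key a ha).2.1
  refine ⟨Set.InvOn.bijOn ⟨hinv, hinv⟩ (fun a ha => (key a ha).1) fun a ha => (key a ha).1,
    fun a ha => (key a ha).2, ?_⟩
  rintro a ⟨ha1, ha2⟩
  obtain ⟨i, rfl⟩ : ∃ i, a = i + 1 := ⟨a - 1, by omega⟩
  obtain ⟨j, hj, e⟩ := hf i
  obtain ⟨h1, h2⟩ := hL.drop_mem hr (shapeLE_stack hP hQ) (by omega) hj
  rw [e, Nat.mod_eq_of_lt h2]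
  omega


end PromRS
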